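/- There exists a constant C_Γ > 0, depending only on the Schottky data, such that for all 0 < τ ≤ σ ≤ 1 and every fixed 𝐚 ∈ Z(τ): #{(𝐛, 𝐜, 𝐝) ∈ Z(τ)³ : 𝐚 ⇝ 𝐛 ⇝ 𝐝, 𝐚 ⇝ 𝐜 ⇝ 𝐝, and |γ'_{𝐚'𝐛'}(x_𝐝) − γ'_{𝐚'𝐜'}(x_𝐝)| ≤ τ² σ} ≤ C_Γ τ^{-3δ} σ^{δ/2}, where x_𝐝 denotes the center of the interval I_𝐝. -/

import Mathlib

open MeasureTheory Set Real Pointwise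

noncomputable section

abbrev SL2 := Matrix.SpecialLinearGroup (Fin 2) ℝ

/-- The Möbius transformation of `ℝ` associated to `g ∈ SL(2,ℝ)` (junk value at the pole). -/
def mobius (g : SL2) (x : ℝ) : ℝ :=
  (g 0 0 * x + g 0 1) / (g 1 0 * x + g 1 1)

/-- The derivative `γ'(x) = (cx+d)⁻²` of the Möbius transformation. -/
def mobiusDeriv (g : SL2) (x : ℝ) : ℝ :=
  ((g 1 0 * x + g 1 1) ^ 2)⁻¹

/-- The derivative of the Möbius transformation in the ball model,
`|γ'(x)|_B = ((1+x²)/(1+γ(x)²)) γ'(x)`. -/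
def mobiusDerivB (g : SL2) (x : ℝ) : ℝ :=
  ((1 + x ^ 2) / (1 + mobius g x ^ 2)) * mobiusDeriv g x

/-- The Möbius action of `SL(2,ℝ)` on `ℝ ∪ {∞}`. -/
def mobiusOP (g : SL2) (x : OnePoint ℝ) : OnePoint ℝ :=
  Option.elim x
    (if g 1 0 = 0 then OnePoint.infty else ((g 0 0 / g 1 0 : ℝ) : OnePoint ℝ))
    (fun y => if g 1 0 * y + g 1 1 = 0 then OnePoint.infty
      else ((mobius g y : ℝ) : OnePoint ℝ))

/-- The pole `γ⁻¹(∞) = -d/c` of `γ = [[a,b],[c,d]]`. -/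
def mobiusPole (g : SL2) : ℝ := -(g 1 1) / (g 1 0)

/-- The distortion factor `α(γ, [x₀,x₁]) = log((γ⁻¹(∞) − x₁)/(γ⁻¹(∞) − x₀))`,
with the convention `α = 0` when `γ⁻¹(∞) = ∞` (i.e. `c = 0`). -/
def alphaDist (g : SL2) (x₀ x₁ : ℝ) : ℝ :=
  if g 1 0 = 0 then 0 else Real.log ((mobiusPole g - x₁) / (mobiusPole g - x₀))

/-- The letter `ā` paired with `a` in the alphabet `{1,…,2r}` (modelled by `Fin (2r)`). -/
def bar {r : ℕ} (a : Fin (2 * r)) : Fin (2 * r) :=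
  if h : (a : ℕ) < r then ⟨(a : ℕ) + r, by omega⟩
  else ⟨(a : ℕ) - r, by have := a.isLt; omega⟩

/-- Schottky data: `2r` disjoint compact intervals `I_a = [ξ₀ a, ξ₁ a]` on the real line and
transformations `γ_a ∈ SL(2,ℝ)` with `γ_ā = γ_a⁻¹` such that `γ_a` maps the complement (in
`ℝ ∪ {∞}`) of the interior of `I_ā` onto `I_a`. -/
structure SchottkyData (r : ℕ) where
  hr : 2 ≤ r
  ξ₀ : Fin (2 * r) → ℝ
  ξ₁ : Fin (2 * r) → ℝ
  hlt : ∀ a, ξ₀ a < ξ₁ a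
  hdisj : ∀ a b, a ≠ b → Disjoint (Icc (ξ₀ a) (ξ₁ a)) (Icc (ξ₀ b) (ξ₁ b))
  γ : Fin (2 * r) → SL2
  hinv : ∀ a, γ (bar a) = (γ a)⁻¹
  hmap : ∀ a, mobiusOP (γ a) ''
      (univ \ ((fun t : ℝ => (t : OnePoint ℝ)) '' Ioo (ξ₀ (bar a)) (ξ₁ (bar a))))
      = (fun t : ℝ => (t : OnePoint ℝ)) '' Icc (ξ₀ a) (ξ₁ a)

namespace SchottkyData

variable {r : ℕ}

/-- `l` is a word: no letter is followed by its bar. -/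
def IsWord (_ : SchottkyData r) (l : List (Fin (2 * r))) : Prop :=
  l.Chain' fun p q => q ≠ bar p

/-- The group element `γ_𝐚 = γ_{a_1} ⋯ γ_{a_n}` of a word. -/
def wordγ (S : SchottkyData r) (l : List (Fin (2 * r))) : SL2 :=
  (l.map S.γ).prod

/-- The interval `I_𝐚 = γ_{𝐚'}(I_{a_n})` of a nonempty word (and `∅` for the empty word). -/
def wordI (S : SchottkyData r) (l : List (Fin (2 * r))) : Set ℝ :=
  if h : l = [] then ∅
  else mobius (S.wordγ l.dropLast) '' Icc (S.ξ₀ (l.getLast h)) (S.ξ₁ (l.getLast h))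

/-- The limit set `Λ_Γ = ⋂_n ⋃_{𝐚 ∈ W_n} I_𝐚`. -/
def limitSet (S : SchottkyData r) : Set ℝ :=
  ⋂ n : ℕ, ⋃ (l : List (Fin (2 * r))) (_ : S.IsWord l ∧ l.length = n + 1), S.wordI l

/-- `μ` is the (δ-conformal) Patterson–Sullivan measure: a Borel probability measure
supported on the limit set satisfying the equivariance property under the group
generated by the Schottky transformations. -/
def IsPS (S : SchottkyData r) (δ : ℝ) (μ : Measure ℝ) : Prop :=
  IsProbabilityMeasure μ ∧ μ S.limitSetᶜ = 0 ∧
    ∀ g ∈ Subgroup.closure (Set.range S.γ), ∀ f : ℝ → ℝ, Measurable f →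
      (∃ C, ∀ x, |f x| ≤ C) →
      ∫ x, f x ∂μ = ∫ x, f (mobius g x) * mobiusDerivB g x ^ δ ∂μ

/-- The partition `Z(τ) = {𝐚 ∈ W° : |I_𝐚| ≤ τ < |I_{𝐚'}|}` (with `|I_∅| = ∞`). -/
def Zpart (S : SchottkyData r) (τ : ℝ) : Set (List (Fin (2 * r))) :=
  {l | S.IsWord l ∧ l ≠ [] ∧ (MeasureTheory.volume (S.wordI l)).toReal ≤ τ ∧
    (l.dropLast = [] ∨ τ < (MeasureTheory.volume (S.wordI l.dropLast)).toReal)}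

end SchottkyData

/-- The length `|I|` of an interval `I ⊂ ℝ`. -/
def ivlen (I : Set ℝ) : ℝ := (MeasureTheory.volume I).toReal

/-- `𝐚 ⇝ 𝐛` : the last letter of `𝐚` equals the first letter of `𝐛`. -/
def chn {X : Type*} (l m : List X) : Prop :=
  ∃ (h1 : l ≠ []) (h2 : m ≠ []), l.getLast h1 = m.head h2

/-- The center of an interval. -/
def ctr (I : Set ℝ) : ℝ := (sInf I + sSup I) / 2

end

noncomputable section
open MeasureTheory Set Real
namespace TC

def den (g : SL2) (x : ℝ) : ℝ := g 1 0 * x + g 1 1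

lemma det_eq (g : SL2) : g 0 0 * g 1 1 - g 0 1 * g 1 0 = 1 := by
  have h := g.det_coe
  rwa [Matrix.det_fin_two] at h

lemma mul_ent (g h : SL2) (i j : Fin 2) : (g * h) i j = g i 0 * h 0 j + g i 1 * h 1 j := by
  simp [Matrix.SpecialLinearGroup.coe_mul, Matrix.mul_apply, Fin.sum_univ_two]

lemma inv_ent (g : SL2) : g⁻¹ 0 0 = g 1 1 ∧ g⁻¹ 1 0 = - g 1 0 := by
  rw [Matrix.SpecialLinearGroup.coe_inv, Matrix.adjugate_fin_two]
  simp

lemma den_mul (g h : SL2) (x : ℝ) (hx : den h x ≠ 0) :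
    den (g * h) x = den g (mobius h x) * den h x := by
  unfold den mobius at *
  rw [mul_ent, mul_ent]
  field_simp
  ring

lemma mobius_mul (g h : SL2) (x : ℝ) (hx : den h x ≠ 0) :
    mobius (g * h) x = mobius g (mobius h x) := by
  have h1 := den_mul g h x hx
  have h2 : (g * h) 0 0 * x + (g * h) 0 1
      = (g 0 0 * mobius h x + g 0 1) * den h x := by
    unfold den mobius at *
    rw [mul_ent, mul_ent]
    field_simp
    ring
  unfold den at h1
  rw [mobius, h1, h2, mobius]
  exact mul_div_mul_right _ _ hx

lemma mobius_sub (g : SL2) (x y : ℝ) (hx : den g x ≠ 0) (hy : den g y ≠ 0) :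
    mobius g x - mobius g y = (x - y) / (den g x * den g y) := by
  have := det_eq g
  unfold mobius
  change _ / den g x - _ / den g y = _
  rw [div_sub_div _ _ hx hy]
  congr 1
  unfold den
  linear_combination (x - y) * this

lemma mobius_inj (g : SL2) (x y : ℝ) (hx : den g x ≠ 0) (hy : den g y ≠ 0)
    (h : mobius g x = mobius g y) : x = y := by
  have := mobius_sub g x y hx hy
  rw [h, sub_self, eq_comm, div_eq_zero_iff] at this
  rcases this with h | h
  · linarith
  · exact absurd h (mul_ne_zero hx hy)

lemma inf_mul (g h : SL2) (hc : h 1 0 ≠ 0) :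
    (g * h) 1 0 = den g (h 0 0 / h 1 0) * h 1 0 ∧
    (den g (h 0 0 / h 1 0) ≠ 0 →
      (g * h) 0 0 / (g * h) 1 0 = mobius g (h 0 0 / h 1 0)) := by
  have h1 : (g * h) 1 0 = den g (h 0 0 / h 1 0) * h 1 0 := by
    rw [mul_ent, den]; field_simp
  have h2 : (g * h) 0 0 = (g 0 0 * (h 0 0 / h 1 0) + g 0 1) * h 1 0 := by
    rw [mul_ent]; field_simp
  refine ⟨h1, fun _ => ?_⟩
  rw [h1, h2, mobius]
  exact mul_div_mul_right _ _ hc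

variable {r : ℕ}

lemma bar_bar (a : Fin (2 * r)) : bar (bar a) = a := by
  have := a.isLt
  by_cases h : (a : ℕ) < r
  · have h1 : bar a = ⟨(a : ℕ) + r, by omega⟩ := by simp [bar, h]
    rw [h1]; simp [bar]
  · have h1 : bar a = ⟨(a : ℕ) - r, by omega⟩ := by simp [bar, h]
    have h2 : (a : ℕ) - r < r := by omega
    rw [h1]
    apply Fin.ext
    simp [bar, h2]
    omega

abbrev L (S : SchottkyData r) (a : Fin (2 * r)) : Set ℝ := Icc (S.ξ₀ a) (S.ξ₁ a)

variable (S : SchottkyData r)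

lemma IsWord_iff (w : List (Fin (2 * r))) :
    S.IsWord w ↔ List.IsChain (fun p q => q ≠ bar p) w := Iff.rfl

lemma bar_ne (S : SchottkyData r) (a : Fin (2 * r)) : bar a ≠ a := by
  have := S.hr
  intro h
  have h := congrArg Fin.val h
  unfold bar at h
  have := a.isLt
  split_ifs at h <;> simp at h <;> omega

lemma L_unique {a b : Fin (2 * r)} {x : ℝ} (ha : x ∈ L S a) (hb : x ∈ L S b) : a = b := by
  by_contra h
  exact (Set.disjoint_left.1 (S.hdisj a b h)) ha hb

lemma gamma_inf (a : Fin (2 * r)) :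
    (S.γ a) 1 0 ≠ 0 ∧ (S.γ a) 0 0 / (S.γ a) 1 0 ∈ L S a := by
  have h : mobiusOP (S.γ a) OnePoint.infty ∈
      (fun t : ℝ => (t : OnePoint ℝ)) '' Icc (S.ξ₀ a) (S.ξ₁ a) := by
    rw [← S.hmap a]
    refine ⟨_, ⟨mem_univ _, ?_⟩, rfl⟩
    rintro ⟨t, _, ht⟩
    exact OnePoint.coe_ne_infty t ht
  obtain ⟨t, ht, h⟩ := h
  change (t : OnePoint ℝ) = if (S.γ a) 1 0 = 0 then OnePoint.infty
    else (((S.γ a) 0 0 / (S.γ a) 1 0 : ℝ) : OnePoint ℝ) at h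
  split_ifs at h with hc
  · exact absurd h (OnePoint.coe_ne_infty t)
  · refine ⟨hc, ?_⟩
    rw [← OnePoint.coe_injective h]; exact ht

lemma gamma_map (a b : Fin (2 * r)) (hab : b ≠ bar a) (x : ℝ) (hx : x ∈ L S b) :
    den (S.γ a) x ≠ 0 ∧ mobius (S.γ a) x ∈ L S a := by
  have h : mobiusOP (S.γ a) (x : OnePoint ℝ) ∈
      (fun t : ℝ => (t : OnePoint ℝ)) '' Icc (S.ξ₀ a) (S.ξ₁ a) := by
    rw [← S.hmap a]
    refine ⟨_, ⟨mem_univ _, ?_⟩, rfl⟩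
    rintro ⟨t, ht, ht'⟩
    have := OnePoint.coe_injective ht'
    rw [this] at ht
    exact hab (L_unique S hx (Ioo_subset_Icc_self ht))
  obtain ⟨t, ht, h⟩ := h
  change (t : OnePoint ℝ) = if (S.γ a) 1 0 * x + (S.γ a) 1 1 = 0 then OnePoint.infty
    else ((mobius (S.γ a) x : ℝ) : OnePoint ℝ) at h
  split_ifs at h with hc
  · exact absurd h (OnePoint.coe_ne_infty t)
  · refine ⟨hc, ?_⟩
    rw [← OnePoint.coe_injective h]; exact ht

lemma wordγ_append (u v : List (Fin (2 * r))) :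
    S.wordγ (u ++ v) = S.wordγ u * S.wordγ v := by
  simp [SchottkyData.wordγ]

lemma wordγ_cons (a : Fin (2 * r)) (v : List (Fin (2 * r))) :
    S.wordγ (a :: v) = S.γ a * S.wordγ v := by
  simp [SchottkyData.wordγ]

lemma wordγ_single (a : Fin (2 * r)) :
    S.wordγ [a] = S.γ a := by
  simp [SchottkyData.wordγ]

lemma wordγ_nil : S.wordγ [] = 1 := by
  simp [SchottkyData.wordγ]

lemma den_one (x : ℝ) : den 1 x = 1 := by
  simp [den]

lemma mobius_one (x : ℝ) : mobius 1 x = x := by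
  simp [mobius]

lemma word_map (w : List (Fin (2 * r))) : ∀ (a j : Fin (2 * r)), S.IsWord (a :: w ++ [j]) →
    ∀ x ∈ L S j, den (S.wordγ (a :: w)) x ≠ 0 ∧ mobius (S.wordγ (a :: w)) x ∈ L S a := by
  induction w with
  | nil =>
    intro a j h x hx
    rw [wordγ_single]
    have : j ≠ bar a := by
      simpa [IsWord_iff] using h
    exact gamma_map S a j this x hx
  | cons b w ih =>
    intro a j h x hx
    have h' : b ≠ bar a ∧ S.IsWord (b :: w ++ [j]) := by
      simpa [IsWord_iff] using h
    obtain ⟨h1, h2⟩ := ih b j h'.2 x hx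
    obtain ⟨h3, h4⟩ := gamma_map S a b h'.1 _ h2
    rw [wordγ_cons]
    refine ⟨?_, ?_⟩
    · rw [den_mul _ _ _ h1]; exact mul_ne_zero h3 h1
    · rw [mobius_mul _ _ _ h1]; exact h4

lemma word_den (w : List (Fin (2 * r))) (j : Fin (2 * r)) (h : S.IsWord (w ++ [j])) 
    (x : ℝ) (hx : x ∈ L S j) : den (S.wordγ w) x ≠ 0 := by
  cases w with
  | nil => rw [wordγ_nil, den_one]; exact one_ne_zero
  | cons a w => exact (word_map S w a j h x hx).1

lemma wordI_concat (w : List (Fin (2 * r))) (j : Fin (2 * r)) :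
    S.wordI (w ++ [j]) = mobius (S.wordγ w) '' L S j := by
  simp [SchottkyData.wordI]

lemma wordI_single (j : Fin (2 * r)) : S.wordI [j] = L S j := by
  have := wordI_concat S [] j
  rw [List.nil_append] at this
  rw [this, wordγ_nil]
  have : mobius 1 = id := by funext x; exact mobius_one x
  rw [this, image_id]

lemma IsWord_left {u v : List (Fin (2 * r))} (h : S.IsWord (u ++ v)) : S.IsWord u :=
  (List.isChain_append.1 h).1

lemma IsWord_right {u v : List (Fin (2 * r))} (h : S.IsWord (u ++ v)) : S.IsWord v :=
  (List.isChain_append.1 h).2.1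

lemma exists_concat {X : Type*} (w : List X) (h : w ≠ []) : ∃ w' j, w = w' ++ [j] :=
  ⟨w.dropLast, w.getLast h, (List.dropLast_append_getLast h).symm⟩

lemma wordI_sub (u v : List (Fin (2 * r))) (hu : u ≠ []) (h : S.IsWord (u ++ v)) :
    S.wordI (u ++ v) ⊆ S.wordI u := by
  obtain ⟨u, j, rfl⟩ := exists_concat u hu
  by_cases hv : v = []
  · subst hv; simp
  obtain ⟨v, k, rfl⟩ := exists_concat v hv
  rw [← List.append_assoc, wordI_concat, wordI_concat]
  rintro _ ⟨x, hx, rfl⟩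
  have hw : S.IsWord (j :: v ++ [k]) := by
    apply IsWord_right S (u := u); simpa using h
  obtain ⟨h1, h2⟩ := word_map S v j k hw x hx
  refine ⟨_, h2, ?_⟩
  rw [← mobius_mul _ _ _ h1, ← wordγ_append]
  simp

lemma wordI_head (a : Fin (2 * r)) (w : List (Fin (2 * r))) (h : S.IsWord (a :: w)) :
    S.wordI (a :: w) ⊆ L S a := by
  rw [← wordI_single]
  exact wordI_sub S [a] w (by simp) (by simpa using h)

lemma word_inf (w : List (Fin (2 * r))) (hw : w ≠ []) (h : S.IsWord w) :
    (S.wordγ w) 1 0 ≠ 0 ∧ (S.wordγ w) 0 0 / (S.wordγ w) 1 0 ∈ S.wordI w := by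
  obtain ⟨w, j, rfl⟩ := exists_concat w hw
  obtain ⟨h1, h2⟩ := gamma_inf S j
  have h3 := word_den S w j h _ h2
  obtain ⟨h4, h5⟩ := inf_mul (S.wordγ w) (S.γ j) h1
  rw [wordγ_append, wordγ_single, wordI_concat]
  refine ⟨?_, ?_⟩
  · rw [h4]; exact mul_ne_zero h3 h1
  · rw [h5 h3]; exact ⟨_, h2, rfl⟩

def wbar (w : List (Fin (2 * r))) : List (Fin (2 * r)) := (w.map bar).reverse

lemma IsWord_wbar {w : List (Fin (2 * r))} (h : S.IsWord w) : S.IsWord (wbar w) := by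
  rw [IsWord_iff, wbar, List.isChain_reverse, List.isChain_map]
  refine List.IsChain.imp ?_ h
  intro a b hab h
  rw [bar_bar] at h
  exact hab h.symm

lemma wordγ_wbar (w : List (Fin (2 * r))) : S.wordγ (wbar w) = (S.wordγ w)⁻¹ := by
  induction w with
  | nil => simp [wbar, wordγ_nil]
  | cons a w ih =>
    have : wbar (a :: w) = wbar w ++ [bar a] := by simp [wbar]
    rw [this, wordγ_append, wordγ_single, wordγ_cons, ih, S.hinv, mul_inv_rev]

def cc (w : List (Fin (2 * r))) : ℝ := (S.wordγ w) 1 0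
def pole (w : List (Fin (2 * r))) : ℝ := -(S.wordγ w) 1 1 / (S.wordγ w) 1 0

lemma cc_ne (w : List (Fin (2 * r))) (hw : w ≠ []) (h : S.IsWord w) : cc S w ≠ 0 :=
  (word_inf S w hw h).1

lemma pole_mem (w : List (Fin (2 * r))) (hw : w ≠ []) (h : S.IsWord w) :
    pole S w ∈ S.wordI (wbar w) := by
  have h1 := (word_inf S (wbar w) (by simpa [wbar] using hw) (IsWord_wbar S h)).2
  rw [wordγ_wbar, (inv_ent _).1, (inv_ent _).2, div_neg, ← neg_div] at h1
  exact h1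

lemma cc_wbar (w : List (Fin (2 * r))) : cc S (wbar w) = - cc S w := by
  rw [cc, wordγ_wbar, (inv_ent _).2]; rfl

lemma den_eq (w : List (Fin (2 * r))) (hw : w ≠ []) (h : S.IsWord w) (x : ℝ) :
    den (S.wordγ w) x = cc S w * (x - pole S w) := by
  have := cc_ne S w hw h
  unfold den pole cc at *
  field_simp
  ring

lemma pole_mem_last (w : List (Fin (2 * r))) (j : Fin (2 * r)) (h : S.IsWord (w ++ [j])) :
    pole S (w ++ [j]) ∈ L S (bar j) := by
  have h1 := pole_mem S _ (by simp) h
  have : wbar (w ++ [j]) = bar j :: wbar w := by simp [wbar]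
  rw [this] at h1
  refine wordI_head S _ _ ?_ h1
  rw [← this]; exact IsWord_wbar S h

lemma cc_append (u v : List (Fin (2 * r))) (hu : u ≠ []) (hv : v ≠ []) (h : S.IsWord (u ++ v)) :
    ∃ y ∈ S.wordI v, cc S (u ++ v) = cc S u * cc S v * (y - pole S u) := by
  obtain ⟨h1, h2⟩ := word_inf S v hv (IsWord_right S h)
  refine ⟨_, h2, ?_⟩
  rw [cc, wordγ_append, (inf_mul _ _ h1).1, den_eq S u hu (IsWord_left S h)]
  unfold cc; ring

end TC

end

noncomputable section
open MeasureTheory Set Real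
namespace TC
variable {r : ℕ} (S : SchottkyData r)

structure Good (K : ℝ) : Prop where
  one_le : 1 ≤ K
  gap : ∀ i j, i ≠ j → ∀ x ∈ L S i, ∀ y ∈ L S j, K⁻¹ ≤ |x - y|
  bd : ∀ i, ∀ x ∈ L S i, |x| ≤ K
  len : ∀ i, K⁻¹ ≤ S.ξ₁ i - S.ξ₀ i
  cl : ∀ i, K⁻¹ ≤ |cc S [i]|
  cu : ∀ i, |cc S [i]| ≤ K

lemma ev_inv_le (ε : ℝ) (h : 0 < ε) : ∀ᶠ K : ℝ in Filter.atTop, K⁻¹ ≤ ε :=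
  tendsto_inv_atTop_zero.eventually_le_const h

lemma exists_good : ∃ K, Good S K := by
  have h1 : ∀ᶠ K : ℝ in Filter.atTop, ∀ i j, i ≠ j → ∀ x ∈ L S i, ∀ y ∈ L S j, K⁻¹ ≤ |x - y| := by
    rw [Filter.eventually_all]; intro i
    rw [Filter.eventually_all]; intro j
    by_cases hij : i = j
    · exact Filter.Eventually.of_forall (fun K h => absurd hij h)
    have hd := S.hdisj i j hij
    have hi := S.hlt i
    have hj := S.hlt j
    rcases lt_or_ge (S.ξ₁ i) (S.ξ₀ j) with h | h
    · filter_upwards [ev_inv_le (S.ξ₀ j - S.ξ₁ i) (by linarith)] with K hK _ x hx y hy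
      rw [abs_sub_comm]
      refine hK.trans (le_trans ?_ (le_abs_self _))
      linarith [hx.2, hy.1]
    rcases lt_or_ge (S.ξ₁ j) (S.ξ₀ i) with h' | h'
    · filter_upwards [ev_inv_le (S.ξ₀ i - S.ξ₁ j) (by linarith)] with K hK _ x hx y hy
      refine hK.trans (le_trans ?_ (le_abs_self _))
      linarith [hx.1, hy.2]
    exfalso
    exact Set.disjoint_left.1 hd
      (show max (S.ξ₀ i) (S.ξ₀ j) ∈ _ from ⟨le_max_left _ _, max_le hi.le h⟩)
      ⟨le_max_right _ _, max_le h' hj.le⟩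
  have h2 : ∀ᶠ K : ℝ in Filter.atTop, ∀ i, ∀ x ∈ L S i, |x| ≤ K := by
    rw [Filter.eventually_all]; intro i
    filter_upwards [Filter.eventually_ge_atTop |S.ξ₀ i|, Filter.eventually_ge_atTop |S.ξ₁ i|]
      with K h1 h2 x hx
    rw [abs_le] at *
    exact ⟨h1.1.trans hx.1, hx.2.trans h2.2⟩
  have h3 : ∀ᶠ K : ℝ in Filter.atTop, ∀ i, K⁻¹ ≤ S.ξ₁ i - S.ξ₀ i := by
    rw [Filter.eventually_all]; intro i
    exact ev_inv_le _ (sub_pos.2 (S.hlt i))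
  have h4 : ∀ᶠ K : ℝ in Filter.atTop, ∀ i, K⁻¹ ≤ |cc S [i]| := by
    rw [Filter.eventually_all]; intro i
    refine ev_inv_le _ (abs_pos.2 (cc_ne S _ (by simp) ?_))
    simp [IsWord_iff]
  have h5 : ∀ᶠ K : ℝ in Filter.atTop, ∀ i, |cc S [i]| ≤ K := by
    rw [Filter.eventually_all]; intro i
    exact Filter.eventually_ge_atTop _
  obtain ⟨K, h0, h1, h2, h3, h4, h5⟩ :=
    ((Filter.eventually_ge_atTop (1 : ℝ)).and
      (h1.and (h2.and (h3.and (h4.and h5))))).exists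
  exact ⟨K, h0, h1, h2, h3, h4, h5⟩

lemma last_ne {w : List (Fin (2 * r))} {i j : Fin (2 * r)} (h : S.IsWord (w ++ [i] ++ [j])) :
    bar i ≠ j := by
  have : S.IsWord ([i] ++ [j]) := IsWord_right S (u := w) (by simpa using h)
  have : j ≠ bar i := by simpa [IsWord_iff] using this
  exact this.symm

lemma den_pos (w : List (Fin (2 * r))) (j : Fin (2 * r)) (h : S.IsWord (w ++ [j])) (x y : ℝ)
    (hx : x ∈ L S j) (hy : y ∈ L S j) : 0 < den (S.wordγ w) x * den (S.wordγ w) y := by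
  by_cases hw : w = []
  · subst hw; simp [wordγ_nil, den_one]
  have h' := IsWord_left S h
  have hp : pole S w ∉ L S j := by
    intro hp
    have := word_den S w j h _ hp
    rw [den_eq S w hw h'] at this
    simp at this
  have hc := cc_ne S w hw h'
  rw [den_eq S w hw h', den_eq S w hw h']
  have : 0 < (x - pole S w) * (y - pole S w) := by
    by_cases h1 : pole S w < S.ξ₀ j
    · exact mul_pos (by linarith [hx.1]) (by linarith [hy.1])
    · have : S.ξ₁ j < pole S w := by
        by_contra h2
        exact hp ⟨not_lt.1 h1, not_lt.1 h2⟩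
      exact mul_pos_of_neg_of_neg (by linarith [hx.2]) (by linarith [hy.2])
  have h2 : 0 < cc S w ^ 2 := by positivity
  calc (0:ℝ) < cc S w ^ 2 * ((x - pole S w) * (y - pole S w)) := mul_pos h2 this
    _ = _ := by ring

lemma wordI_Icc (w : List (Fin (2 * r))) (j : Fin (2 * r)) (h : S.IsWord (w ++ [j])) :
    mobius (S.wordγ w) (S.ξ₀ j) < mobius (S.wordγ w) (S.ξ₁ j) ∧
    S.wordI (w ++ [j]) = Icc (mobius (S.wordγ w) (S.ξ₀ j)) (mobius (S.wordγ w) (S.ξ₁ j)) ∧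
    ivlen (S.wordI (w ++ [j])) =
      (S.ξ₁ j - S.ξ₀ j) / (den (S.wordγ w) (S.ξ₁ j) * den (S.wordγ w) (S.ξ₀ j)) := by
  have hj := S.hlt j
  have m0 : S.ξ₀ j ∈ L S j := left_mem_Icc.2 hj.le
  have m1 : S.ξ₁ j ∈ L S j := right_mem_Icc.2 hj.le
  have hd := word_den S w j h
  have hmono : ∀ x ∈ L S j, ∀ y ∈ L S j, x < y → mobius (S.wordγ w) x < mobius (S.wordγ w) y := by
    intro x hx y hy hxy
    rw [← sub_pos, mobius_sub _ _ _ (hd y hy) (hd x hx)]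
    exact div_pos (by linarith) (den_pos S w j h y x hy hx)
  have hm : MonotoneOn (mobius (S.wordγ w)) (L S j) :=
    (show StrictMonoOn _ _ from fun x hx y hy hxy => hmono x hx y hy hxy).monotoneOn
  have hcont : ContinuousOn (mobius (S.wordγ w)) (L S j) := by
    unfold mobius
    apply ContinuousOn.div (by fun_prop) (by fun_prop)
    intro x hx; exact hd x hx
  have h1 := hmono _ m0 _ m1 hj
  have h2 : S.wordI (w ++ [j])
      = Icc (mobius (S.wordγ w) (S.ξ₀ j)) (mobius (S.wordγ w) (S.ξ₁ j)) := by
    rw [wordI_concat]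
    apply subset_antisymm
    · rintro _ ⟨x, hx, rfl⟩
      exact ⟨hm m0 hx hx.1, hm hx m1 hx.2⟩
    · exact intermediate_value_Icc hj.le hcont
  refine ⟨h1, h2, ?_⟩
  rw [h2, ivlen, Real.volume_Icc, ENNReal.toReal_ofReal (by linarith),
    mobius_sub _ _ _ (hd _ m1) (hd _ m0)]

/-- abstract interval form -/
lemma wordI_form (w : List (Fin (2 * r))) (hw : w ≠ []) (h : S.IsWord w) :
    ∃ p q, p < q ∧ S.wordI w = Icc p q ∧ ivlen (S.wordI w) = q - p := by
  obtain ⟨w, j, rfl⟩ := exists_concat w hw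
  obtain ⟨h1, h2, _⟩ := wordI_Icc S w j h
  refine ⟨_, _, h1, h2, ?_⟩
  rw [h2, ivlen, Real.volume_Icc, ENNReal.toReal_ofReal (by linarith)]

lemma ctr_mem (w : List (Fin (2 * r))) (hw : w ≠ []) (h : S.IsWord w) :
    ctr (S.wordI w) ∈ S.wordI w := by
  obtain ⟨p, q, h1, h2, _⟩ := wordI_form S w hw h
  rw [h2, ctr, csInf_Icc h1.le, csSup_Icc h1.le]
  constructor <;> linarith

lemma ivlen_pos (w : List (Fin (2 * r))) (hw : w ≠ []) (h : S.IsWord w) :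
    0 < ivlen (S.wordI w) := by
  obtain ⟨p, q, h1, h2, h3⟩ := wordI_form S w hw h
  linarith

lemma dist_le_ivlen (w : List (Fin (2 * r))) (hw : w ≠ []) (h : S.IsWord w) (x y : ℝ)
    (hx : x ∈ S.wordI w) (hy : y ∈ S.wordI w) : |x - y| ≤ ivlen (S.wordI w) := by
  obtain ⟨p, q, h1, h2, h3⟩ := wordI_form S w hw h
  rw [h2] at hx hy
  rw [h3, abs_le]
  constructor <;> linarith [hx.1, hx.2, hy.1, hy.2]

variable {S} {K : ℝ}

lemma Good.pos (hK : Good S K) : 0 < K := by linarith [hK.one_le]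

lemma Good.ub (hK : Good S K) (i j) (x) (hx : x ∈ L S i) (y) (hy : y ∈ L S j) :
    |x - y| ≤ 2 * K := by
  have h1 := abs_le.1 (hK.bd i x hx)
  have h2 := abs_le.1 (hK.bd j y hy)
  rw [abs_le]; constructor <;> linarith

lemma Good.pole_dist (hK : Good S K) (w : List (Fin (2 * r))) (hw : w ≠ []) (j : Fin (2 * r))
    (h : S.IsWord (w ++ [j])) (x : ℝ) (hx : x ∈ L S j) :
    K⁻¹ ≤ |x - pole S w| ∧ |x - pole S w| ≤ 2 * K := by
  obtain ⟨w, i, rfl⟩ := exists_concat w hw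
  have h1 := pole_mem_last S w i (IsWord_left S h)
  exact ⟨hK.gap _ _ (last_ne S h).symm _ hx _ h1, hK.ub _ _ _ hx _ h1⟩

lemma wordI_bd (hK : Good S K) (w : List (Fin (2 * r))) (hw : w ≠ []) (h : S.IsWord w) (x : ℝ)
    (hx : x ∈ S.wordI w) : |x| ≤ K := by
  cases w with
  | nil => exact absurd rfl hw
  | cons a w => exact hK.bd a x (wordI_head S a w h hx)

lemma cc_append_bd (hK : Good S K) (u v : List (Fin (2 * r))) (hu : u ≠ []) (hv : v ≠ [])
    (h : S.IsWord (u ++ v)) :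
    |cc S u| * |cc S v| * K⁻¹ ≤ |cc S (u ++ v)| ∧
    |cc S (u ++ v)| ≤ |cc S u| * |cc S v| * (2 * K) := by
  obtain ⟨y, hy, h1⟩ := cc_append S u v hu hv h
  rw [h1, abs_mul, abs_mul]
  cases v with
  | nil => exact absurd rfl hv
  | cons a v =>
    have h2 := wordI_head S a v (IsWord_right S h) hy
    have h3 : S.IsWord (u ++ [a]) := IsWord_left S (v := v) (by simpa using h)
    obtain ⟨h4, h5⟩ := hK.pole_dist u hu a h3 y h2
    constructor <;> gcongr

lemma den_comp (hK : Good S K) (w : List (Fin (2 * r))) (j : Fin (2 * r))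
    (h : S.IsWord (w ++ [j])) (x y : ℝ) (hx : x ∈ L S j) (hy : y ∈ L S j) :
    |den (S.wordγ w) x| ≤ 2 * K ^ 2 * |den (S.wordγ w) y| := by
  have hK1 := hK.one_le
  have hK0 := hK.pos
  by_cases hw : w = []
  · subst hw
    simp [wordγ_nil, den_one]
    nlinarith
  · rw [den_eq S w hw (IsWord_left S h), den_eq S w hw (IsWord_left S h), abs_mul, abs_mul]
    have h1 := (hK.pole_dist w hw j h x hx).2
    have h2 := (hK.pole_dist w hw j h y hy).1
    calc |cc S w| * |x - pole S w| ≤ |cc S w| * (2 * K) := by gcongr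
      _ = 2 * K ^ 2 * (|cc S w| * K⁻¹) := by field_simp
      _ ≤ _ := by gcongr

/-- derivative comparable to interval length -/
lemma deriv_comp (hK : Good S K) (w : List (Fin (2 * r))) (j : Fin (2 * r))
    (h : S.IsWord (w ++ [j])) (x : ℝ) (hx : x ∈ L S j) :
    mobiusDeriv (S.wordγ w) x ≤ 4 * K ^ 5 * ivlen (S.wordI (w ++ [j])) ∧
    ivlen (S.wordI (w ++ [j])) ≤ 8 * K ^ 5 * mobiusDeriv (S.wordγ w) x := by
  have hK1 := hK.one_le
  have hK0 := hK.pos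
  obtain ⟨_, _, h3⟩ := wordI_Icc S w j h
  have hj := S.hlt j
  have m0 : S.ξ₀ j ∈ L S j := left_mem_Icc.2 hj.le
  have m1 : S.ξ₁ j ∈ L S j := right_mem_Icc.2 hj.le
  have hd := word_den S w j h
  have hp := den_pos S w j h _ _ m1 m0
  rw [h3]
  change ((den (S.wordγ w) x) ^ 2)⁻¹ ≤ _ ∧ _ ≤ 8 * K ^ 5 * ((den (S.wordγ w) x) ^ 2)⁻¹
  rw [← abs_of_pos hp, abs_mul, ← sq_abs]
  have hx0 := abs_pos.2 (hd x hx)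
  have hx1 := abs_pos.2 (hd _ m1)
  have hx2 := abs_pos.2 (hd _ m0)
  have a1 := den_comp hK w j h _ _ m1 hx
  have a2 := den_comp hK w j h _ _ m0 hx
  have b1 := den_comp hK w j h _ _ hx m1
  have b2 := den_comp hK w j h _ _ hx m0
  have l1 := hK.len j
  have l2 := (le_abs_self _).trans (hK.ub j j _ m1 _ m0)
  generalize |den (S.wordγ w) x| = X at *
  generalize |den (S.wordγ w) (S.ξ₀ j)| = Y at *
  generalize |den (S.wordγ w) (S.ξ₁ j)| = Z at *
  generalize S.ξ₁ j - S.ξ₀ j = l at *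
  constructor
  · rw [inv_le_comm₀ (by positivity) (by have : 0 < l := lt_of_lt_of_le (by positivity) l1
                                         positivity)]
    have : (4 * K ^ 5 * (l / (Z * Y)))⁻¹ = Z * Y / (4 * K ^ 5 * l) := by
      field_simp
    rw [this, div_le_iff₀ (by have : 0 < l := lt_of_lt_of_le (by positivity) l1
                              positivity)]
    calc Z * Y ≤ (2 * K ^ 2 * X) * (2 * K ^ 2 * X) := by gcongr
      _ = X ^ 2 * (4 * K ^ 5 * K⁻¹) := by field_simp; ring
      _ ≤ _ := by gcongr
  · rw [div_le_iff₀ (by positivity)]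
    calc l ≤ 2 * K := l2
      _ = 8 * K ^ 5 * (X ^ 2)⁻¹ * ((X / (2 * K ^ 2)) * (X / (2 * K ^ 2))) := by
        field_simp; ring
      _ ≤ _ := by
        have c1 : X / (2 * K ^ 2) ≤ Z := by rw [div_le_iff₀ (by positivity)]; linarith
        have c2 : X / (2 * K ^ 2) ≤ Y := by rw [div_le_iff₀ (by positivity)]; linarith
        gcongr

lemma cc_comp (hK : Good S K) (w : List (Fin (2 * r))) (hw : w ≠ []) (h : S.IsWord w) :
    ivlen (S.wordI w) * cc S w ^ 2 ≤ 8 * K ^ 7 ∧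
    1 ≤ 4 * K ^ 7 * (ivlen (S.wordI w) * cc S w ^ 2) := by
  have hK1 := hK.one_le
  have hK0 := hK.pos
  obtain ⟨w, j, rfl⟩ := exists_concat w hw
  obtain ⟨_, _, h3⟩ := wordI_Icc S w j h
  have hj := S.hlt j
  have m0 : S.ξ₀ j ∈ L S j := left_mem_Icc.2 hj.le
  have m1 : S.ξ₁ j ∈ L S j := right_mem_Icc.2 hj.le
  have hp := den_pos S w j h _ _ m1 m0
  rw [h3, ← abs_of_pos hp, abs_mul, ← sq_abs (cc S _)]
  have l1 := hK.len j
  have l2 := (le_abs_self _).trans (hK.ub j j _ m1 _ m0)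
  have cl := hK.cl j
  have cu := hK.cu j
  by_cases hw : w = []
  · subst hw
    simp only [wordγ_nil, den_one, List.nil_append, abs_one, mul_one, div_one]
    generalize |cc S [j]| = c at *
    generalize S.ξ₁ j - S.ξ₀ j = l at *
    have e1 : K ^ 3 ≤ K ^ 7 := pow_le_pow_right₀ hK1 (by norm_num)
    have hc : 0 ≤ c := le_trans (by positivity) cl
    have e2 : 0 < K⁻¹ := by positivity
    constructor
    · calc l * c ^ 2 ≤ (2 * K) * K ^ 2 := by gcongr
        _ = 2 * K ^ 3 := by ring
        _ ≤ _ := by nlinarith [pow_pos hK0 7]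
    · calc (1:ℝ) = K ^ 3 * (K⁻¹ * K⁻¹ ^ 2) := by field_simp
        _ ≤ (4 * K ^ 7) * (l * c ^ 2) := by
          have hl0 : 0 ≤ l := by linarith
          gcongr
          nlinarith [pow_pos hK0 7]
  · obtain ⟨y, hy, h1⟩ := cc_append S w [j] hw (by simp) h
    rw [wordI_single] at hy
    have h' := IsWord_left S h
    have hc := abs_pos.2 (cc_ne S w hw h')
    rw [den_eq S w hw h', den_eq S w hw h', h1]
    simp only [abs_mul]
    obtain ⟨a1, a2⟩ := hK.pole_dist w hw j h _ hy
    obtain ⟨b1, b2⟩ := hK.pole_dist w hw j h _ m0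
    obtain ⟨c1, c2⟩ := hK.pole_dist w hw j h _ m1
    generalize |cc S [j]| = c at *
    generalize S.ξ₁ j - S.ξ₀ j = l at *
    generalize |cc S w| = N at *
    generalize |y - pole S w| = Y at *
    generalize |S.ξ₀ j - pole S w| = Z at *
    generalize |S.ξ₁ j - pole S w| = T at *
    have e2 : 0 < K⁻¹ := by positivity
    have hT : 0 < T := by linarith
    have hZ : 0 < Z := by linarith
    have hY : 0 < Y := by linarith
    have hc0 : 0 < c := by linarith
    have hl0 : 0 < l := by linarith
    have : l / (N * T * (N * Z)) * (N * c * Y) ^ 2 = l * c ^ 2 * Y ^ 2 / (T * Z) := by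
      field_simp
    rw [this]
    constructor
    · rw [div_le_iff₀ (by positivity)]
      calc l * c ^ 2 * Y ^ 2 ≤ (2 * K) * K ^ 2 * (2 * K) ^ 2 := by gcongr
        _ = 8 * K ^ 7 * (K⁻¹ * K⁻¹) := by field_simp; ring
        _ ≤ _ := by gcongr
    · rw [mul_div_assoc', le_div_iff₀ (by positivity)]
      calc 1 * (T * Z) ≤ 1 * ((2 * K) * (2 * K)) := by gcongr
        _ = 4 * K ^ 7 * (K⁻¹ * K⁻¹ ^ 2 * K⁻¹ ^ 2) := by field_simp; ring
        _ ≤ _ := by gcongr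

end TC

end

noncomputable section
open MeasureTheory Set Real
namespace TC
variable {r : ℕ} {S : SchottkyData r} {K : ℝ}

lemma prefix_trichotomy {X : Type*} (u : List X) : ∀ v : List X, u <+: v ∨ v <+: u ∨
    ∃ p i j u' v', i ≠ j ∧ u = p ++ [i] ++ u' ∧ v = p ++ [j] ++ v' := by
  induction u with
  | nil => intro v; left; exact ⟨_, List.nil_append _⟩
  | cons a u ih =>
    intro v
    cases v with
    | nil => right; left; exact ⟨_, List.nil_append _⟩
    | cons b v =>
      by_cases hab : a = b
      · subst hab
        rcases ih v with h | h | ⟨p, i, j, u', v', h1, h2, h3⟩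
        · left; simpa using h
        · right; left; simpa using h
        · right; right
          exact ⟨a :: p, i, j, u', v', h1, by simp [h2], by simp [h3]⟩
      · right; right
        exact ⟨[], a, b, u, v, hab, by simp, by simp⟩

lemma disj_letters (p : List (Fin (2 * r))) (i j : Fin (2 * r)) (hij : i ≠ j)
    (h1 : S.IsWord (p ++ [i])) (h2 : S.IsWord (p ++ [j])) :
    Disjoint (S.wordI (p ++ [i])) (S.wordI (p ++ [j])) := by
  rw [wordI_concat, wordI_concat, Set.disjoint_left]
  rintro _ ⟨x, hx, rfl⟩ ⟨y, hy, h⟩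
  have := mobius_inj _ _ _ (word_den S p j h2 y hy) (word_den S p i h1 x hx) h
  rw [this] at hy
  exact hij (L_unique S hx hy)

lemma disj_words (u v : List (Fin (2 * r))) (hu : S.IsWord u) (hv : S.IsWord v)
    (h1 : ¬ u <+: v) (h2 : ¬ v <+: u) : Disjoint (S.wordI u) (S.wordI v) := by
  rcases prefix_trichotomy u v with h | h | ⟨p, i, j, u', v', h3, rfl, rfl⟩
  · exact absurd h h1
  · exact absurd h h2
  · exact Disjoint.mono (wordI_sub S _ _ (by simp) hu) (wordI_sub S _ _ (by simp) hv)
      (disj_letters p i j h3 (IsWord_left S hu) (IsWord_left S hv))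

lemma ivlen_mono (u v : List (Fin (2 * r))) (hu : u ≠ []) (h : S.IsWord (u ++ v)) :
    ivlen (S.wordI (u ++ v)) ≤ ivlen (S.wordI u) := by
  have h1 := wordI_sub S u v hu h
  obtain ⟨p, q, _, h2, _⟩ := wordI_form S u hu (IsWord_left S h)
  unfold ivlen
  apply ENNReal.toReal_mono _ (measure_mono h1)
  rw [h2]; simp

/-- children are not much smaller -/
lemma child_ge (hK : Good S K) (w : List (Fin (2 * r))) (hw : w ≠ []) (j : Fin (2 * r))
    (h : S.IsWord (w ++ [j])) :
    ivlen (S.wordI w) ≤ 128 * K ^ 18 * ivlen (S.wordI (w ++ [j])) := by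
  have hK1 := hK.one_le
  have hK0 := hK.pos
  have h1 := (cc_comp hK w hw (IsWord_left S h)).1
  have h2 := (cc_comp hK (w ++ [j]) (by simp) h).2
  have h3 := (cc_append_bd hK w [j] hw (by simp) h).2
  have h4 := hK.cu j
  have hc := abs_pos.2 (cc_ne S w hw (IsWord_left S h))
  have hi := ivlen_pos S (w ++ [j]) (by simp) h
  rw [← sq_abs (cc S _)] at h1 h2
  have h5 : |cc S (w ++ [j])| ≤ |cc S w| * (2 * K ^ 2) := by
    calc _ ≤ _ := h3
      _ ≤ |cc S w| * K * (2 * K) := by gcongr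
      _ = _ := by ring
  have hc' := abs_nonneg (cc S (w ++ [j]))
  generalize |cc S (w ++ [j])| = c' at *
  generalize |cc S w| = c at *
  generalize ivlen (S.wordI (w ++ [j])) = l' at *
  generalize ivlen (S.wordI w) = l at *
  have h6 : 1 ≤ 4 * K ^ 7 * (l' * (c * (2 * K ^ 2)) ^ 2) := h2.trans (by gcongr)
  have h7 : l * c ^ 2 ≤ (128 * K ^ 18 * l') * c ^ 2 := by
    calc l * c ^ 2 ≤ 8 * K ^ 7 * 1 := by linarith
      _ ≤ 8 * K ^ 7 * (4 * K ^ 7 * (l' * (c * (2 * K ^ 2)) ^ 2)) := by gcongr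
      _ = _ := by ring
  exact le_of_mul_le_mul_right h7 (by positivity)

lemma exists_other (S : SchottkyData r) (i j : Fin (2 * r)) : ∃ k, k ≠ i ∧ k ≠ j := by
  have h : ({i, j} : Finset (Fin (2 * r))).card < Fintype.card (Fin (2 * r)) := by
    have := S.hr
    have := Finset.card_le_two (a := i) (b := j)
    simp only [Fintype.card_fin]; omega
  obtain ⟨k, hk⟩ := Finset.exists_mem_notMem_of_card_lt_card
    (s := {i, j}) (t := Finset.univ) (by simpa using h)
  refine ⟨k, ?_, ?_⟩ <;> rintro rfl <;> simp at hk

lemma IsWord_snoc (w : List (Fin (2 * r))) (i k : Fin (2 * r)) (h : S.IsWord (w ++ [i]))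
    (hk : k ≠ bar i) : S.IsWord (w ++ [i] ++ [k]) := by
  rw [IsWord_iff] at *
  refine List.isChain_append.2 ⟨h, by simp, ?_⟩
  simpa using hk

/-- contraction ratio -/
def th (K : ℝ) : ℝ := 1 - (128 * K ^ 18)⁻¹

lemma th_nonneg (hK : Good S K) : 0 ≤ th K := by
  have hK1 := hK.one_le
  unfold th
  have : (1:ℝ) ≤ 128 * K ^ 18 := by
    have := one_le_pow₀ hK1 (n := 18)
    linarith
  have := inv_le_one_of_one_le₀ this
  linarith

lemma th_lt (hK : Good S K) : th K < 1 := by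
  have := hK.pos
  unfold th
  have : 0 < (128 * K ^ 18)⁻¹ := by positivity
  linarith

lemma child_le (hK : Good S K) (w : List (Fin (2 * r))) (hw : w ≠ []) (j : Fin (2 * r))
    (h : S.IsWord (w ++ [j])) :
    ivlen (S.wordI (w ++ [j])) ≤ th K * ivlen (S.wordI w) := by
  have hK0 := hK.pos
  obtain ⟨w, i, rfl⟩ := exists_concat w hw
  obtain ⟨k, hk1, hk2⟩ := exists_other S j (bar i)
  have hk := IsWord_snoc w i k (IsWord_left S h) hk2
  have h1 := child_ge hK (w ++ [i]) (by simp) k hk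
  have h2 := disj_letters (w ++ [i]) j k hk1.symm h hk
  have h3 := wordI_sub S (w ++ [i]) [j] (by simp) h
  have h4 := wordI_sub S (w ++ [i]) [k] (by simp) hk
  have h5 : ivlen (S.wordI (w ++ [i] ++ [j])) + ivlen (S.wordI (w ++ [i] ++ [k]))
      ≤ ivlen (S.wordI (w ++ [i])) := by
    obtain ⟨p, q, _, hf, _⟩ := wordI_form S (w ++ [i]) (by simp) (IsWord_left S h)
    obtain ⟨p1, q1, _, hf1, _⟩ := wordI_form S (w ++ [i] ++ [j]) (by simp) h
    obtain ⟨p2, q2, _, hf2, _⟩ := wordI_form S (w ++ [i] ++ [k]) (by simp) hk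
    unfold ivlen
    rw [← ENNReal.toReal_add (by rw [hf1]; simp) (by rw [hf2]; simp),
      ← measure_union h2 (by rw [hf2]; exact measurableSet_Icc)]
    apply ENNReal.toReal_mono (by rw [hf]; simp)
    exact measure_mono (union_subset h3 h4)
  have h6 : (128 * K ^ 18)⁻¹ * ivlen (S.wordI (w ++ [i])) ≤ ivlen (S.wordI (w ++ [i] ++ [k])) := by
    rw [inv_mul_le_iff₀ (by positivity)]; exact h1
  unfold th
  linarith

lemma contract (hK : Good S K) (u : List (Fin (2 * r))) (hu : u ≠ []) (v : List (Fin (2 * r))) :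
    S.IsWord (u ++ v) → ivlen (S.wordI (u ++ v)) ≤ th K ^ v.length * ivlen (S.wordI u) := by
  induction v using List.reverseRecOn with
  | nil => intro h; simp
  | append_singleton v j ih =>
    intro h
    rw [← List.append_assoc] at h ⊢
    have h1 := ih (IsWord_left S h)
    have h2 := child_le hK (u ++ v) (by simp [hu]) j h
    have h3 := th_nonneg hK
    calc _ ≤ _ := h2
      _ ≤ th K * (th K ^ v.length * ivlen (S.wordI u)) := by gcongr
      _ = _ := by simp [pow_succ]; ring

lemma ivlen_le (hK : Good S K) (w : List (Fin (2 * r))) (hw : w ≠ []) (h : S.IsWord w) :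
    ivlen (S.wordI w) ≤ th K ^ (w.length - 1) * (2 * K) := by
  cases w with
  | nil => exact absurd rfl hw
  | cons a w =>
    have h1 := contract hK [a] (by simp) w (by simpa using h)
    have h2 : ivlen (S.wordI [a]) ≤ 2 * K := by
      rw [wordI_single, ivlen, Real.volume_Icc, ENNReal.toReal_ofReal (by linarith [S.hlt a])]
      refine (le_abs_self _).trans (hK.ub a a _ ?_ _ ?_)
      · exact right_mem_Icc.2 (S.hlt a).le
      · exact left_mem_Icc.2 (S.hlt a).le
    have h3 := th_nonneg hK
    simp only [List.singleton_append] at h1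
    refine h1.trans ?_
    simp only [List.length_cons, Nat.add_sub_cancel]
    gcongr

lemma exists_len (hK : Good S K) (ε : ℝ) (hε : 0 < ε) : ∃ n : ℕ, ∀ w : List (Fin (2 * r)),
    w ≠ [] → S.IsWord w → n ≤ w.length → ivlen (S.wordI w) < ε := by
  have hK0 := hK.pos
  obtain ⟨n, hn⟩ := exists_pow_lt_of_lt_one (show 0 < ε / (2 * K) by positivity) (th_lt hK)
  refine ⟨n + 1, fun w hw h hl => ?_⟩
  have h1 := ivlen_le hK w hw h
  have h2 : th K ^ (w.length - 1) ≤ th K ^ n :=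
    pow_le_pow_of_le_one (th_nonneg hK) (th_lt hK).le (by omega)
  calc _ ≤ _ := h1
    _ ≤ th K ^ n * (2 * K) := by gcongr
    _ < ε / (2 * K) * (2 * K) := by gcongr
    _ = ε := by field_simp

lemma mem_Z {τ : ℝ} {w : List (Fin (2 * r))} : w ∈ S.Zpart τ ↔
    S.IsWord w ∧ w ≠ [] ∧ ivlen (S.wordI w) ≤ τ ∧
      (w.dropLast = [] ∨ τ < ivlen (S.wordI w.dropLast)) := Iff.rfl

lemma Z_finite (S : SchottkyData r) (τ : ℝ) (hτ : 0 < τ) : (S.Zpart τ).Finite := by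
  obtain ⟨K, hK⟩ := exists_good S
  obtain ⟨n, hn⟩ := exists_len hK τ hτ
  apply Set.Finite.subset (List.finite_length_le (Fin (2 * r)) (n + 1))
  intro w hw
  obtain ⟨h1, h2, h3, h4⟩ := mem_Z.1 hw
  change w.length ≤ n + 1
  obtain ⟨w, j, rfl⟩ := exists_concat w h2
  rw [List.dropLast_concat] at h4
  rcases h4 with h4 | h4
  · simp [h4]
  · by_contra h5
    have h6 : n < w.length := by simpa using h5
    have := hn w (by rintro rfl; simp at h6) (IsWord_left S h1) h6.le
    linarith

lemma Z_lower (hK : Good S K) (τ : ℝ) (hτ : τ ≤ 1) (w : List (Fin (2 * r)))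
    (hw : w ∈ S.Zpart τ) : τ ≤ 128 * K ^ 18 * ivlen (S.wordI w) := by
  have hK1 := hK.one_le
  have hK0 := hK.pos
  obtain ⟨h1, h2, h3, h4⟩ := mem_Z.1 hw
  obtain ⟨w, j, rfl⟩ := exists_concat w h2
  rw [List.dropLast_concat] at h4
  by_cases hw0 : w = []
  · subst hw0
    have h5 : K⁻¹ ≤ ivlen (S.wordI ([] ++ [j])) := by
      rw [List.nil_append, wordI_single, ivlen, Real.volume_Icc,
        ENNReal.toReal_ofReal (by linarith [S.hlt j])]
      exact hK.len j
    calc τ ≤ 1 := hτ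
      _ ≤ K ^ 17 := one_le_pow₀ hK1
      _ = K ^ 18 * K⁻¹ := by field_simp
      _ ≤ 128 * K ^ 18 * ivlen (S.wordI ([] ++ [j])) := by
        gcongr
        have := pow_pos hK0 18
        linarith
  · rcases h4 with h4 | h4
    · exact absurd h4 hw0
    · exact h4.le.trans (child_ge hK w hw0 j h1)

lemma Z_comparable {τ : ℝ} {u v : List (Fin (2 * r))} (hu : u ∈ S.Zpart τ) (hv : v ∈ S.Zpart τ)
    (h : u <+: v) : u = v := by
  obtain ⟨h1, h2, h3, _⟩ := mem_Z.1 hu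
  obtain ⟨k1, k2, _, k4⟩ := mem_Z.1 hv
  obtain ⟨t, rfl⟩ := h
  by_cases ht : t = []
  · simp [ht]
  exfalso
  obtain ⟨t, j, rfl⟩ := exists_concat t ht
  rw [← List.append_assoc, List.dropLast_concat] at k4
  rw [← List.append_assoc] at k1
  rcases k4 with k4 | k4
  · simp [h2] at k4
  · have := ivlen_mono u t h2 (IsWord_left S k1)
    linarith

lemma Z_disj {τ : ℝ} {u v : List (Fin (2 * r))} (hu : u ∈ S.Zpart τ) (hv : v ∈ S.Zpart τ)
    (h : u ≠ v) : Disjoint (S.wordI u) (S.wordI v) := by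
  apply disj_words u v hu.1 hv.1
  · intro h'; exact h (Z_comparable hu hv h')
  · intro h'; exact h (Z_comparable hv hu h').symm

lemma exists_Z_initial (τ : ℝ) (w : List (Fin (2 * r))) : w ≠ [] → S.IsWord w →
    ivlen (S.wordI w) ≤ τ → ∃ u ∈ S.Zpart τ, u <+: w := by
  induction w using List.reverseRecOn with
  | nil => intro h; exact absurd rfl h
  | append_singleton w j ih =>
    intro _ h1 h2
    by_cases h3 : w = [] ∨ τ < ivlen (S.wordI w)
    · refine ⟨w ++ [j], mem_Z.2 ⟨h1, by simp, h2, ?_⟩, List.prefix_rfl⟩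
      rwa [List.dropLast_concat]
    · push Not at h3
      obtain ⟨u, hu, hp⟩ := ih h3.1 (IsWord_left S h1) h3.2
      exact ⟨u, hu, hp.trans (List.prefix_append _ _)⟩

lemma limit_cover (S : SchottkyData r) (τ : ℝ) (hτ : 0 < τ) (x : ℝ) (hx : x ∈ S.limitSet) :
    ∃ w ∈ S.Zpart τ, x ∈ S.wordI w := by
  obtain ⟨K, hK⟩ := exists_good S
  obtain ⟨n, hn⟩ := exists_len hK τ hτ
  have := Set.mem_iInter.1 hx n
  simp only [mem_iUnion] at this
  obtain ⟨w, ⟨h1, h2⟩, h3⟩ := this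
  have h0 : w ≠ [] := by rintro rfl; simp at h2
  obtain ⟨u, hu, t, rfl⟩ := exists_Z_initial τ w h0 h1 (hn w h0 h1 (by omega)).le
  exact ⟨u, hu, wordI_sub S u t hu.2.1 h1 h3⟩

lemma wordI_meas (w : List (Fin (2 * r))) (hw : w ≠ []) (h : S.IsWord w) :
    MeasurableSet (S.wordI w) := by
  obtain ⟨p, q, _, h2, _⟩ := wordI_form S w hw h
  rw [h2]; exact measurableSet_Icc

/-- generic disjoint counting -/
lemma count_disj (ν : Measure ℝ) (F : Finset (List (Fin (2 * r)))) (B : Set ℝ) (hB : ν B ≠ ⊤)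
    (m : ℝ) (hF : ∀ w ∈ F, S.IsWord w ∧ w ≠ [] ∧ S.wordI w ⊆ B ∧ m ≤ (ν (S.wordI w)).toReal)
    (hd : ∀ u ∈ F, ∀ v ∈ F, u ≠ v → Disjoint (S.wordI u) (S.wordI v)) :
    F.card * m ≤ (ν B).toReal := by
  have h1 : ν (⋃ w ∈ F, S.wordI w) = ∑ w ∈ F, ν (S.wordI w) := by
    apply measure_biUnion_finset
    · intro u hu v hv huv; exact hd u hu v hv huv
    · intro w hw; exact wordI_meas w (hF w hw).2.1 (hF w hw).1
  have h2 : ν (⋃ w ∈ F, S.wordI w) ≤ ν B :=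
    measure_mono (iUnion₂_subset fun w hw => (hF w hw).2.2.1)
  have h3 : ∀ w ∈ F, ν (S.wordI w) ≠ ⊤ := fun w hw =>
    ne_top_of_le_ne_top hB (measure_mono (hF w hw).2.2.1)
  calc (F.card : ℝ) * m = ∑ w ∈ F, m := by simp
    _ ≤ ∑ w ∈ F, (ν (S.wordI w)).toReal := Finset.sum_le_sum fun w hw => (hF w hw).2.2.2
    _ = (ν (⋃ w ∈ F, S.wordI w)).toReal := by rw [h1, ENNReal.toReal_sum h3]
    _ ≤ _ := ENNReal.toReal_mono hB h2

end TC

end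

noncomputable section
open MeasureTheory Set Real
namespace TC
variable {r : ℕ} {S : SchottkyData r} {K δ : ℝ} {μ : Measure ℝ}

lemma wordγ_mem (w : List (Fin (2 * r))) : S.wordγ w ∈ Subgroup.closure (Set.range S.γ) := by
  apply Subgroup.list_prod_mem
  intro x hx
  obtain ⟨a, _, rfl⟩ := List.mem_map.1 hx
  exact Subgroup.subset_closure ⟨a, rfl⟩

lemma derivB_zero (g : SL2) (x : ℝ) (h : den g x = 0) : mobiusDerivB g x = 0 := by
  unfold den at h
  simp [mobiusDerivB, mobiusDeriv, h]

lemma derivB_nonneg (g : SL2) (x : ℝ) : 0 ≤ mobiusDerivB g x := by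
  unfold mobiusDerivB mobiusDeriv
  positivity

lemma meas_formula (hδ0 : 0 < δ) (hμ : S.IsPS δ μ) (w : List (Fin (2 * r))) (j : Fin (2 * r))
    (h : S.IsWord (w ++ [j])) :
    (μ (S.wordI (w ++ [j]))).toReal
      = ∫ x, (L S j).indicator (fun x => mobiusDerivB (S.wordγ w) x ^ δ) x ∂μ := by
  have hm := wordI_meas (w ++ [j]) (by simp) h
  have h1 := hμ.2.2 (S.wordγ w) (wordγ_mem w) ((S.wordI (w ++ [j])).indicator fun _ => 1)
    (measurable_const.indicator hm) ⟨1, fun x => by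
      by_cases hx : x ∈ S.wordI (w ++ [j]) <;> simp [hx]⟩
  rw [integral_indicator hm] at h1
  simp only [integral_const, MeasurableSet.univ, measureReal_restrict_apply, univ_inter,
    smul_eq_mul, mul_one] at h1
  change μ.real _ = _
  rw [h1]
  congr 1
  funext x
  by_cases hx : x ∈ L S j
  · have : mobius (S.wordγ w) x ∈ S.wordI (w ++ [j]) := by
      rw [wordI_concat]; exact ⟨x, hx, rfl⟩
    simp only [indicator_of_mem hx, indicator_of_mem this, one_mul]
  · rw [indicator_of_notMem hx]
    by_cases hd : den (S.wordγ w) x = 0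
    · rw [derivB_zero _ _ hd, zero_rpow hδ0.ne', mul_zero]
    · have : mobius (S.wordγ w) x ∉ S.wordI (w ++ [j]) := by
        rw [wordI_concat]
        rintro ⟨y, hy, hxy⟩
        have := mobius_inj _ _ _ (word_den S w j h y hy) hd hxy
        rw [this] at hy
        exact hx hy
      rw [indicator_of_notMem this, zero_mul]

lemma derivB_bd (hK : Good S K) (w : List (Fin (2 * r))) (j : Fin (2 * r))
    (h : S.IsWord (w ++ [j])) (x : ℝ) (hx : x ∈ L S j) :
    mobiusDerivB (S.wordγ w) x ≤ 8 * K ^ 7 * ivlen (S.wordI (w ++ [j])) ∧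
    (16 * K ^ 7)⁻¹ * ivlen (S.wordI (w ++ [j])) ≤ mobiusDerivB (S.wordγ w) x := by
  have hK1 := hK.one_le
  have hK0 := hK.pos
  obtain ⟨h1, h2⟩ := deriv_comp hK w j h x hx
  have hy : mobius (S.wordγ w) x ∈ S.wordI (w ++ [j]) := by
    rw [wordI_concat]; exact ⟨x, hx, rfl⟩
  have h3 := wordI_bd hK (w ++ [j]) (by simp) h _ hy
  have h4 := hK.bd j x hx
  have h5 : 1 + x ^ 2 ≤ 2 * K ^ 2 := by
    have := sq_le_sq' (abs_le.1 h4).1 (abs_le.1 h4).2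
    nlinarith
  have h6 : 1 + mobius (S.wordγ w) x ^ 2 ≤ 2 * K ^ 2 := by
    have := sq_le_sq' (abs_le.1 h3).1 (abs_le.1 h3).2
    nlinarith
  have h0 : 0 ≤ mobiusDeriv (S.wordγ w) x := by unfold mobiusDeriv; positivity
  have hi := ivlen_pos S (w ++ [j]) (by simp) h
  unfold mobiusDerivB
  generalize mobius (S.wordγ w) x = y at *
  generalize mobiusDeriv (S.wordγ w) x = D at *
  generalize ivlen (S.wordI (w ++ [j])) = l at *
  constructor
  · have : (1 + x ^ 2) / (1 + y ^ 2) ≤ 2 * K ^ 2 := by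
      rw [div_le_iff₀ (by positivity)]
      nlinarith [mul_nonneg (pow_pos hK0 2).le (sq_nonneg y)]
    calc _ ≤ (2 * K ^ 2) * (4 * K ^ 5 * l) := by gcongr
      _ = _ := by ring
  · have h7 : (2 * K ^ 2)⁻¹ ≤ (1 + x ^ 2) / (1 + y ^ 2) := by
      rw [inv_eq_one_div]
      gcongr
      nlinarith
    have h8 : (8 * K ^ 5)⁻¹ * l ≤ D := by
      rw [inv_mul_le_iff₀ (by positivity)]; exact h2
    calc (16 * K ^ 7)⁻¹ * l = (2 * K ^ 2)⁻¹ * ((8 * K ^ 5)⁻¹ * l) := by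
          field_simp; ring
      _ ≤ _ := by gcongr

lemma mu_upper (hK : Good S K) (hδ0 : 0 < δ) (hμ : S.IsPS δ μ) (w : List (Fin (2 * r)))
    (hw : w ≠ []) (h : S.IsWord w) :
    (μ (S.wordI w)).toReal ≤ (8 * K ^ 7 * ivlen (S.wordI w)) ^ δ := by
  have hK0 := hK.pos
  have := hμ.1
  have hi := ivlen_pos S w hw h
  obtain ⟨w, j, rfl⟩ := exists_concat w hw
  rw [meas_formula hδ0 hμ w j h]
  calc _ ≤ ∫ x, (8 * K ^ 7 * ivlen (S.wordI (w ++ [j]))) ^ δ ∂μ := by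
        apply integral_mono_of_nonneg
        · filter_upwards with x
          exact indicator_nonneg (fun x _ => rpow_nonneg (derivB_nonneg _ _) _) x
        · exact integrable_const _
        · filter_upwards with x
          by_cases hx : x ∈ L S j
          · rw [indicator_of_mem hx]
            exact rpow_le_rpow (derivB_nonneg _ _) (derivB_bd hK w j h x hx).1 hδ0.le
          · rw [indicator_of_notMem hx]; positivity
    _ = _ := by simp

lemma mu_lower0 (hK : Good S K) (hδ0 : 0 < δ) (hμ : S.IsPS δ μ) (w : List (Fin (2 * r)))
    (j : Fin (2 * r)) (h : S.IsWord (w ++ [j])) :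
    ((16 * K ^ 7)⁻¹ * ivlen (S.wordI (w ++ [j]))) ^ δ * (μ (L S j)).toReal
      ≤ (μ (S.wordI (w ++ [j]))).toReal := by
  have hK0 := hK.pos
  have := hμ.1
  have hi := ivlen_pos S (w ++ [j]) (by simp) h
  rw [meas_formula hδ0 hμ w j h]
  have hmeas : Measurable fun x => mobiusDerivB (S.wordγ w) x ^ δ := by
    unfold mobiusDerivB mobiusDeriv mobius
    fun_prop
  calc _ = ∫ x, (L S j).indicator
        (fun _ => ((16 * K ^ 7)⁻¹ * ivlen (S.wordI (w ++ [j]))) ^ δ) x ∂μ := by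
        rw [integral_indicator measurableSet_Icc]
        simp [mul_comm, Measure.real]
    _ ≤ _ := by
        apply integral_mono_of_nonneg
        · filter_upwards with x
          exact indicator_nonneg (fun x _ => by positivity) x
        · apply Integrable.of_bound (hmeas.indicator measurableSet_Icc).aestronglyMeasurable
            ((8 * K ^ 7 * ivlen (S.wordI (w ++ [j]))) ^ δ)
          filter_upwards with x
          by_cases hx : x ∈ L S j
          · rw [indicator_of_mem hx, Real.norm_eq_abs,
              abs_of_nonneg (rpow_nonneg (derivB_nonneg _ _) _)]
            exact rpow_le_rpow (derivB_nonneg _ _) (derivB_bd hK w j h x hx).1 hδ0.le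
          · rw [indicator_of_notMem hx, norm_zero]; positivity
        · filter_upwards with x
          by_cases hx : x ∈ L S j
          · rw [indicator_of_mem hx, indicator_of_mem hx]
            exact rpow_le_rpow (by positivity) (derivB_bd hK w j h x hx).2 hδ0.le
          · rw [indicator_of_notMem hx, indicator_of_notMem hx]

lemma letter_pos (hδ0 : 0 < δ) (hμ : S.IsPS δ μ) (j : Fin (2 * r)) : 0 < (μ (L S j)).toReal := by
  obtain ⟨K, hK⟩ := exists_good S
  have hK0 := hK.pos
  have := hμ.1
  have step : ∀ j k, k ≠ bar j → 0 < (μ (L S k)).toReal → 0 < (μ (L S j)).toReal := by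
    intro j k hjk hk
    have hw : S.IsWord ([j] ++ [k]) := by simpa [IsWord_iff] using hjk
    have h1 := mu_lower0 hK hδ0 hμ [j] k hw
    have hi := ivlen_pos S ([j] ++ [k]) (by simp) hw
    have h2 : (μ (S.wordI ([j] ++ [k]))).toReal ≤ (μ (L S j)).toReal := by
      apply ENNReal.toReal_mono (measure_ne_top _ _) (measure_mono _)
      exact wordI_head S j [k] hw
    refine lt_of_lt_of_le ?_ (h1.trans h2)
    positivity
  have h0 : ∃ k, 0 < (μ (L S k)).toReal := by
    by_contra hcon
    push Not at hcon
    have h1 : ∀ k, μ (L S k) = 0 := by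
      intro k
      have := le_antisymm (hcon k) ENNReal.toReal_nonneg
      rcases (ENNReal.toReal_eq_zero_iff _).1 this with h | h
      · exact h
      · exact absurd h (measure_ne_top _ _)
    have h2 : (univ : Set ℝ) ⊆ (⋃ k, L S k) ∪ S.limitSetᶜ := by
      intro x _
      by_cases hx : x ∈ S.limitSet
      · left
        obtain ⟨w, hw, hxw⟩ := limit_cover S 1 one_pos x hx
        cases w with
        | nil => exact absurd rfl hw.2.1
        | cons a w => exact mem_iUnion.2 ⟨a, wordI_head S a w hw.1 hxw⟩
      · right; exact hx
    have h3 : μ univ = 0 := by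
      apply measure_mono_null h2
      rw [measure_union_null_iff]
      exact ⟨measure_iUnion_null h1, hμ.2.1⟩
    simp at h3
  obtain ⟨k, hk⟩ := h0
  by_cases hjk : k = bar j
  · obtain ⟨m, hm1, hm2⟩ := exists_other S j (bar j)
    apply step j m hm2
    apply step m k _ hk
    rw [hjk]
    intro h
    apply hm1
    rw [← bar_bar j, h, bar_bar]
  · exact step j k hjk hk

lemma mu_lower (hδ0 : 0 < δ) (hμ : S.IsPS δ μ) : ∃ m > 0, ∀ w : List (Fin (2 * r)), w ≠ [] →
    S.IsWord w → m * ivlen (S.wordI w) ^ δ ≤ (μ (S.wordI w)).toReal := by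
  obtain ⟨K, hK⟩ := exists_good S
  have hK0 := hK.pos
  have h1 : ∀ᶠ M : ℝ in Filter.atTop, ∀ j, M⁻¹ ≤ (μ (L S j)).toReal := by
    rw [Filter.eventually_all]; intro i
    exact ev_inv_le _ (letter_pos hδ0 hμ i)
  obtain ⟨M, hM0, hM⟩ := ((Filter.eventually_gt_atTop (0:ℝ)).and h1).exists
  refine ⟨((16 * K ^ 7)⁻¹) ^ δ * M⁻¹, by positivity, ?_⟩
  intro w hw h
  have hi := ivlen_pos S w hw h
  obtain ⟨w, j, rfl⟩ := exists_concat w hw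
  refine le_trans ?_ (mu_lower0 hK hδ0 hμ w j h)
  rw [mul_rpow (by positivity) hi.le]
  calc _ = ((16 * K ^ 7)⁻¹) ^ δ * ivlen (S.wordI (w ++ [j])) ^ δ * M⁻¹ := by ring
    _ ≤ _ := by
      gcongr
      exact hM j

/-- upper regularity -/
lemma mu_ball (hδ0 : 0 < δ) (hμ : S.IsPS δ μ) : ∃ C > 0, ∀ q s : ℝ, 0 < s →
    (μ (Icc (q - s) (q + s))).toReal ≤ C * s ^ δ := by
  obtain ⟨K, hK⟩ := exists_good S
  have hK1 := hK.one_le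
  have hK0 := hK.pos
  have := hμ.1
  classical
  refine ⟨512 * K ^ 18 * (8 * K ^ 7) ^ δ + 1, by positivity, ?_⟩
  intro q s hs
  rcases le_or_gt 1 s with h1 | h1
  · calc (μ (Icc (q - s) (q + s))).toReal ≤ 1 := by
          have := prob_le_one (μ := μ) (s := Icc (q - s) (q + s))
          simpa using ENNReal.toReal_mono ENNReal.one_ne_top this
      _ ≤ s ^ δ := one_le_rpow h1 hδ0.le
      _ ≤ _ := by
        have : 0 < s ^ δ := by positivity
        have h2 : 0 ≤ 512 * K ^ 18 * (8 * K ^ 7) ^ δ := by positivity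
        nlinarith
  · have hfin := Z_finite S s hs
    set F := hfin.toFinset.filter (fun w => (S.wordI w ∩ Icc (q - s) (q + s)).Nonempty) with hF
    have hFm : ∀ w ∈ F, w ∈ S.Zpart s ∧ (S.wordI w ∩ Icc (q - s) (q + s)).Nonempty := by
      intro w hw
      simpa [hF] using hw
    have hcard : (F.card : ℝ) ≤ 512 * K ^ 18 := by
      have h2 := count_disj (S := S) volume F (Icc (q - 2 * s) (q + 2 * s)) (by simp)
        ((128 * K ^ 18)⁻¹ * s) ?_ ?_
      · rw [Real.volume_Icc, ENNReal.toReal_ofReal (by linarith)] at h2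
        have h3 : (F.card : ℝ) * (128 * K ^ 18)⁻¹ ≤ 4 := by
          apply le_of_mul_le_mul_right _ hs
          linarith
        rw [← div_eq_mul_inv, div_le_iff₀ (by positivity)] at h3
        linarith
      · intro w hw
        obtain ⟨hz, y, hy1, hy2⟩ := hFm w hw
        refine ⟨hz.1, hz.2.1, ?_, ?_⟩
        · intro x hx
          have h4 := abs_le.1 (dist_le_ivlen S w hz.2.1 hz.1 x y hx hy1)
          have h5 : ivlen (S.wordI w) ≤ s := hz.2.2.1
          constructor <;> linarith [hy2.1, hy2.2]
        · rw [inv_mul_le_iff₀ (by positivity)]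
          exact Z_lower hK s h1.le w hz
      · intro u hu v hv huv
        exact Z_disj (hFm u hu).1 (hFm v hv).1 huv
    have hcov : μ (Icc (q - s) (q + s)) ≤ ∑ w ∈ F, μ (S.wordI w) := by
      have h2 : Icc (q - s) (q + s) ⊆ (⋃ w ∈ F, S.wordI w) ∪ S.limitSetᶜ := by
        intro x hxI
        by_cases hx : x ∈ S.limitSet
        · left
          obtain ⟨w, hw, hxw⟩ := limit_cover S s hs x hx
          refine mem_iUnion₂.2 ⟨w, ?_, hxw⟩
          simp only [hF, Finset.mem_filter, Set.Finite.mem_toFinset]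
          exact ⟨hw, x, hxw, hxI⟩
        · right; exact hx
      calc _ ≤ _ := measure_mono h2
        _ ≤ _ := measure_union_le _ _
        _ ≤ _ := by
          rw [hμ.2.1, add_zero]
          exact measure_biUnion_finset_le F _
    calc (μ (Icc (q - s) (q + s))).toReal ≤ (∑ w ∈ F, μ (S.wordI w)).toReal :=
          ENNReal.toReal_mono (ENNReal.sum_ne_top.2 fun w _ => measure_ne_top _ _) hcov
      _ = ∑ w ∈ F, (μ (S.wordI w)).toReal :=
          ENNReal.toReal_sum fun w _ => measure_ne_top _ _
      _ ≤ ∑ w ∈ F, (8 * K ^ 7) ^ δ * s ^ δ := by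
          apply Finset.sum_le_sum
          intro w hw
          obtain ⟨hz, _⟩ := hFm w hw
          refine (mu_upper hK hδ0 hμ w hz.2.1 hz.1).trans ?_
          rw [← mul_rpow (by positivity) hs.le]
          have := ivlen_pos S w hz.2.1 hz.1
          apply rpow_le_rpow (by positivity) _ hδ0.le
          gcongr
          exact hz.2.2.1
      _ = F.card * ((8 * K ^ 7) ^ δ * s ^ δ) := by simp
      _ ≤ 512 * K ^ 18 * ((8 * K ^ 7) ^ δ * s ^ δ) := by gcongr
      _ ≤ _ := by
        have : 0 < s ^ δ := by positivity
        linarith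

/-- main counting lemma -/
lemma count_ball (hδ0 : 0 < δ) (hμ : S.IsPS δ μ) (c : ℝ) (hc : 1 ≤ c) : ∃ C > 0, ∀ τ q s : ℝ,
    0 < τ → τ ≤ s → ∀ F : Finset (List (Fin (2 * r))),
    (∀ w ∈ F, S.IsWord w ∧ w ≠ [] ∧ τ ≤ c * ivlen (S.wordI w) ∧ ivlen (S.wordI w) ≤ c * τ ∧
      ∃ y ∈ S.wordI w, |y - q| ≤ s) → (F.card : ℝ) ≤ C * τ ^ (-δ) * s ^ δ := by
  obtain ⟨K, hK⟩ := exists_good S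
  have hK1 := hK.one_le
  have hK0 := hK.pos
  have := hμ.1
  classical
  obtain ⟨m, hm, hml⟩ := mu_lower hδ0 hμ
  obtain ⟨C, hC, hCb⟩ := mu_ball hδ0 hμ
  have hc0 : 0 < c := by linarith
  obtain ⟨n, hn⟩ := exists_pow_lt_of_lt_one (show 0 < (c ^ 2)⁻¹ by positivity) (th_lt hK)
  refine ⟨(n + 1) * (C * (1 + c) ^ δ * c ^ δ / m), by positivity, ?_⟩
  intro τ q s hτ hτs F hF
  have hs : 0 < s := by linarith
  have key : ∀ i : ℕ, ((F.filter (fun w => w.length % (n + 1) = i)).card : ℝ)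
      ≤ (C * (1 + c) ^ δ * c ^ δ / m) * τ ^ (-δ) * s ^ δ := by
    intro i
    have hnp : ∀ u v, u ∈ F → v ∈ F → u.length % (n + 1) = i → v.length % (n + 1) = i →
        u ≠ v → ¬ u <+: v := by
      rintro u _ hu hv h1 h2 huv ⟨t, rfl⟩
      obtain ⟨a1, a2, a3, a4, _⟩ := hF _ hu
      obtain ⟨b1, b2, b3, b4, _⟩ := hF _ hv
      have h3 := contract hK u a2 t b1
      have h4 : n ≤ t.length := by
        have ht : 0 < t.length := by
          rcases Nat.eq_zero_or_pos t.length with h | h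
          · exact absurd (by simp [List.length_eq_zero_iff.1 h]) huv
          · exact h
        rw [List.length_append, ← h1] at h2
        have h5 : (n + 1) ∣ t.length := by
          have h6 : u.length + t.length ≡ u.length + 0 [MOD (n + 1)] := h2
          have := Nat.ModEq.add_left_cancel' _ h6
          exact (Nat.modEq_zero_iff_dvd).1 this
        have := Nat.le_of_dvd ht h5
        omega
      have h5 : th K ^ t.length ≤ th K ^ n :=
        pow_le_pow_of_le_one (th_nonneg hK) (th_lt hK).le h4
      have h6 : th K ^ t.length < (c ^ 2)⁻¹ := lt_of_le_of_lt h5 hn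
      have hi := ivlen_pos S u a2 a1
      have h7 : τ < τ := by
        calc τ ≤ c * ivlen (S.wordI (u ++ t)) := b3
          _ ≤ c * (th K ^ t.length * ivlen (S.wordI u)) := by gcongr
          _ < c * ((c ^ 2)⁻¹ * ivlen (S.wordI u)) := by gcongr
          _ ≤ c * ((c ^ 2)⁻¹ * (c * τ)) := by gcongr
          _ = τ := by field_simp
      exact lt_irrefl _ h7
    have h2 := count_disj (S := S) μ (F.filter (fun w => w.length % (n + 1) = i))
      (Icc (q - (1 + c) * s) (q + (1 + c) * s)) (measure_ne_top _ _) (m * (τ / c) ^ δ) ?_ ?_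
    · have h3 := h2.trans (hCb q ((1 + c) * s) (by positivity))
      rw [mul_rpow (by positivity) hs.le, div_rpow hτ.le hc0.le] at h3
      have hτδ : 0 < τ ^ δ := by positivity
      rw [rpow_neg hτ.le]
      rw [← le_div_iff₀ (by positivity)] at h3
      refine h3.trans (le_of_eq ?_)
      field_simp
    · intro w hw
      rw [Finset.mem_filter] at hw
      obtain ⟨a1, a2, a3, a4, y, hy1, hy2⟩ := hF _ hw.1
      refine ⟨a1, a2, ?_, ?_⟩
      · intro x hx
        have h4 := abs_le.1 (dist_le_ivlen S w a2 a1 x y hx hy1)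
        have h5 : c * τ ≤ c * s := by gcongr
        rw [abs_le] at hy2
        constructor <;> linarith [hy2.1, hy2.2]
      · refine le_trans ?_ (hml w a2 a1)
        gcongr
        rw [div_le_iff₀ hc0]; linarith
    · intro u hu v hv huv
      rw [Finset.mem_filter] at hu hv
      apply disj_words u v (hF _ hu.1).1 (hF _ hv.1).1
      · exact hnp u v hu.1 hv.1 hu.2 hv.2 huv
      · exact hnp v u hv.1 hu.1 hv.2 hu.2 huv.symm
  have hsum : F.card = ∑ i ∈ Finset.range (n + 1),
      (F.filter (fun w => w.length % (n + 1) = i)).card := by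
    apply Finset.card_eq_sum_card_fiberwise
    intro w _
    simp only [Finset.coe_range, mem_Iio]
    exact Nat.mod_lt _ (by omega)
  rw [hsum]
  push_cast
  calc _ ≤ ∑ i ∈ Finset.range (n + 1), (C * (1 + c) ^ δ * c ^ δ / m) * τ ^ (-δ) * s ^ δ :=
        Finset.sum_le_sum fun i _ => key i
    _ = _ := by simp; ring

end TC

end

noncomputable section
open MeasureTheory Set Real
namespace TC
variable {r : ℕ} {S : SchottkyData r} {K δ : ℝ} {μ : Measure ℝ}

lemma glue (u v : List (Fin (2 * r))) (j : Fin (2 * r)) (h1 : S.IsWord (u ++ [j]))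
    (h2 : S.IsWord (j :: v)) : S.IsWord (u ++ (j :: v)) := by
  rw [IsWord_iff] at *
  rw [List.isChain_append] at h1 ⊢
  exact ⟨h1.1, h2, by simpa using h1.2.2⟩

lemma Z_drop (hK : Good S K) {τ : ℝ} (hτ : τ < K⁻¹) {w : List (Fin (2 * r))}
    (hw : w ∈ S.Zpart τ) : ∃ w' j, w = w' ++ [j] ∧ w' ≠ [] ∧ S.IsWord (w' ++ [j]) ∧
      τ ≤ ivlen (S.wordI w') ∧ ivlen (S.wordI w') ≤ 128 * K ^ 18 * τ := by
  have hK0 := hK.pos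
  obtain ⟨h1, h2, h3, h4⟩ := mem_Z.1 hw
  obtain ⟨w, j, rfl⟩ := exists_concat w h2
  rw [List.dropLast_concat] at h4
  have hw0 : w ≠ [] := by
    rintro rfl
    have h5 : K⁻¹ ≤ ivlen (S.wordI ([] ++ [j])) := by
      rw [List.nil_append, wordI_single, ivlen, Real.volume_Icc,
        ENNReal.toReal_ofReal (by linarith [S.hlt j])]
      exact hK.len j
    linarith
  refine ⟨w, j, rfl, hw0, h1, ?_, ?_⟩
  · rcases h4 with h4 | h4
    · exact absurd h4 hw0
    · exact h4.le
  · refine (child_ge hK w hw0 j h1).trans ?_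
    gcongr

/-- size of the lower-left coefficient for words of length comparable to `τ` -/
lemma cc_size (hK : Good S K) {τ : ℝ} {w : List (Fin (2 * r))} (hw : w ≠ [])
    (h : S.IsWord w) (h1 : τ ≤ ivlen (S.wordI w)) (h2 : ivlen (S.wordI w) ≤ 128 * K ^ 18 * τ) :
    τ * cc S w ^ 2 ≤ 8 * K ^ 7 ∧ 1 ≤ 512 * K ^ 25 * (τ * cc S w ^ 2) := by
  have hK0 := hK.pos
  obtain ⟨h3, h4⟩ := cc_comp hK w hw h
  constructor
  · exact le_trans (by gcongr) h3
  · calc (1:ℝ) ≤ _ := h4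
      _ ≤ 4 * K ^ 7 * (128 * K ^ 18 * τ * cc S w ^ 2) := by gcongr
      _ = _ := by ring

lemma pair_info (hK : Good S K) {τ : ℝ} (hτ0 : 0 < τ) (hτ : τ < K⁻¹)
    {a b d : List (Fin (2 * r))}
    (ha : a ∈ S.Zpart τ) (hb : b ∈ S.Zpart τ) (hd : d ∈ S.Zpart τ)
    (hab : chn a b) (hbd : chn b d) :
    let w := a.dropLast ++ b.dropLast
    let x := ctr (S.wordI d)
    let v := wbar b.dropLast
    mobiusDeriv (S.wordγ w) x = ((cc S w * (x - pole S w)) ^ 2)⁻¹ ∧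
    (K⁻¹ ≤ |x - pole S w| ∧ |x - pole S w| ≤ 2 * K) ∧
    ((512 * K ^ 26)⁻¹ ≤ τ * |cc S w| ∧ τ * |cc S w| ≤ 512 * K ^ 26) ∧
    (S.IsWord v ∧ v ≠ [] ∧ τ ≤ 4096 * K ^ 32 * ivlen (S.wordI v) ∧
      ivlen (S.wordI v) ≤ 4096 * K ^ 32 * τ ∧ pole S w ∈ S.wordI v) := by
  intro w x v
  have hK1 := hK.one_le
  have hK0 := hK.pos
  obtain ⟨a', j, rfl, ha0, haw, ha1, ha2⟩ := Z_drop hK hτ ha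
  obtain ⟨b', k, rfl, hb0, hbw, hb1, hb2⟩ := Z_drop hK hτ hb
  obtain ⟨_, _, hab⟩ := hab
  obtain ⟨_, hd0, hbd⟩ := hbd
  rw [List.getLast_append_singleton] at hab hbd
  have hx : x ∈ L S k := by
    have := ctr_mem S d hd0 hd.1
    cases d with
    | nil => exact absurd rfl hd0
    | cons d0 d =>
      simp only [List.head_cons] at hbd
      rw [hbd]
      exact wordI_head S d0 d hd.1 this
  have hw : w = a' ++ b' := by simp [w]
  have hv : v = wbar b' := by simp [v]
  rw [hw, hv]
  clear_value x
  clear hw hv w v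
  have hword : S.IsWord (a' ++ b' ++ [k]) := by
    cases b' with
    | nil => exact absurd rfl hb0
    | cons b0 b' =>
      simp only [List.cons_append, List.head_cons] at hab
      subst hab
      have := glue a' (b' ++ [k]) j haw hbw
      simpa using this
  have hw' := IsWord_left S hword
  have hw0 : a' ++ b' ≠ [] := by simp [ha0]
  have hb' := IsWord_left S hbw
  have ha' := IsWord_left S haw
  obtain ⟨sa1, sa2⟩ := cc_size hK ha0 ha' ha1 ha2
  obtain ⟨sb1, sb2⟩ := cc_size hK hb0 hb' hb1 hb2
  refine ⟨?_, hK.pole_dist _ hw0 k hword x hx, ?_, IsWord_wbar S hb', ?_, ?_, ?_, ?_⟩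
  · rw [← den_eq S _ hw0 hw']; rfl
  · obtain ⟨c1, c2⟩ := cc_append_bd hK a' b' ha0 hb0 hw'
    rw [← sq_abs] at sa1 sa2 sb1 sb2
    have na := abs_nonneg (cc S a')
    have nb := abs_nonneg (cc S b')
    generalize |cc S a'| = A at *
    generalize |cc S b'| = B at *
    generalize |cc S (a' ++ b')| = C at *
    constructor
    · have e1 : 1 ≤ (512 * K ^ 25 * (τ * (A * B))) ^ 2 := by
        calc (1:ℝ) = 1 * 1 := by ring
          _ ≤ _ := mul_le_mul sa2 sb2 zero_le_one (by positivity)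
          _ = _ := by ring
      have e2 : 1 ≤ 512 * K ^ 25 * (τ * (A * B)) := by
        by_contra hcon
        push Not at hcon
        have : (512 * K ^ 25 * (τ * (A * B))) ^ 2 < 1 := by
          apply pow_lt_one₀ (by positivity) hcon (by norm_num)
        linarith
      rw [inv_le_iff_one_le_mul₀ (by positivity)]
      calc (1:ℝ) ≤ _ := e2
        _ = τ * (A * B * K⁻¹) * (512 * K ^ 26) := by field_simp
        _ ≤ _ := by gcongr
    · have e1 : (τ * (A * B)) ^ 2 ≤ (8 * K ^ 7) ^ 2 := by
        calc _ = (τ * A ^ 2) * (τ * B ^ 2) := by ring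
          _ ≤ (8 * K ^ 7) * (8 * K ^ 7) := by gcongr
          _ = _ := by ring
      have e2 := le_of_sq_le_sq e1 (by positivity)
      have e3 : K ^ 8 ≤ K ^ 26 := pow_le_pow_right₀ hK1 (by norm_num)
      have e4 : 0 < K ^ 8 := by positivity
      calc τ * C ≤ τ * (A * B * (2 * K)) := by gcongr
        _ = (τ * (A * B)) * (2 * K) := by ring
        _ ≤ (8 * K ^ 7) * (2 * K) := by gcongr
        _ = 16 * K ^ 8 := by ring
        _ ≤ _ := by linarith
  · simpa [wbar] using hb0
  · obtain ⟨c1, c2⟩ := cc_comp hK (wbar b') (by simpa [wbar] using hb0) (IsWord_wbar S hb')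
    have hi := ivlen_pos S (wbar b') (by simpa [wbar] using hb0) (IsWord_wbar S hb')
    rw [cc_wbar, neg_sq] at c2
    have hc : 0 < cc S b' ^ 2 := by
      have := cc_ne S b' hb0 hb'
      positivity
    apply le_of_mul_le_mul_right _ hc
    calc τ * cc S b' ^ 2 ≤ 8 * K ^ 7 * 1 := by linarith
      _ ≤ 8 * K ^ 7 * (4 * K ^ 7 * (ivlen (S.wordI (wbar b')) * cc S b' ^ 2)) := by gcongr
      _ = 32 * K ^ 14 * (ivlen (S.wordI (wbar b')) * cc S b' ^ 2) := by ring
      _ ≤ 4096 * K ^ 32 * (ivlen (S.wordI (wbar b')) * cc S b' ^ 2) := by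
        gcongr
        · norm_num
        · norm_num
      _ = _ := by ring
  · obtain ⟨c1, c2⟩ := cc_comp hK (wbar b') (by simpa [wbar] using hb0) (IsWord_wbar S hb')
    rw [cc_wbar, neg_sq] at c1
    have hc : 0 < cc S b' ^ 2 := by
      have := cc_ne S b' hb0 hb'
      positivity
    apply le_of_mul_le_mul_right _ hc
    calc _ ≤ 8 * K ^ 7 * 1 := by linarith
      _ ≤ 8 * K ^ 7 * (512 * K ^ 25 * (τ * cc S b' ^ 2)) := by gcongr
      _ = _ := by ring
  · have h1 := pole_mem S (a' ++ b') hw0 hw'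
    have h2 : wbar (a' ++ b') = wbar b' ++ wbar a' := by simp [wbar]
    have h3 := IsWord_wbar S hw'
    rw [h2] at h1 h3
    exact wordI_sub S _ _ (by simpa [wbar] using hb0) h3 h1

/-- sign selection -/
lemma real_sign (u v B τ σ : ℝ) (hB : 0 < B) (hτ : 0 < τ)
    (hu1 : B⁻¹ ≤ τ * |u|) (hu2 : τ * |u| ≤ B) (hv1 : B⁻¹ ≤ τ * |v|) (hv2 : τ * |v| ≤ B)
    (h : |(u ^ 2)⁻¹ - (v ^ 2)⁻¹| ≤ τ ^ 2 * σ) :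
    τ * |u - 1 * v| ≤ B ^ 5 * σ ∨ τ * |u - (-1) * v| ≤ B ^ 5 * σ := by
  have hB' : 0 < B⁻¹ := by positivity
  have hu : u ≠ 0 := by rintro rfl; simp at hu1; linarith
  have hv : v ≠ 0 := by rintro rfl; simp at hv1; linarith
  have e0 : (u ^ 2)⁻¹ - (v ^ 2)⁻¹ = -((u - v) * (u + v)) / (u ^ 2 * v ^ 2) := by
    field_simp; ring
  have hσ : 0 ≤ σ := by
    have := (abs_nonneg _).trans h
    by_contra hn
    nlinarith [pow_pos hτ 2]
  rw [e0, abs_div, abs_neg, abs_mul, div_le_iff₀ (by positivity),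
    abs_of_nonneg (by positivity : 0 ≤ u ^ 2 * v ^ 2)] at h
  have e1 : (τ * |u - v|) * (τ * |u + v|) ≤ B ^ 4 * σ := by
    calc _ = τ ^ 2 * (|u - v| * |u + v|) := by ring
      _ ≤ τ ^ 2 * (τ ^ 2 * σ * (u ^ 2 * v ^ 2)) := by gcongr
      _ = (τ * |u|) ^ 2 * (τ * |v|) ^ 2 * σ := by
        rw [mul_pow, mul_pow, sq_abs, sq_abs]; ring
      _ ≤ B ^ 2 * B ^ 2 * σ := by gcongr
      _ = _ := by ring
  have e2 : 2 * |u| ≤ |u - v| + |u + v| := by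
    calc 2 * |u| = |(u - v) + (u + v)| := by
          rw [show (u - v) + (u + v) = 2 * u by ring, abs_mul]; norm_num
      _ ≤ _ := abs_add_le _ _
  have e3 : 2 * B⁻¹ ≤ τ * |u - v| + τ * |u + v| := by nlinarith
  rw [one_mul, neg_one_mul, sub_neg_eq_add]
  have n1 : 0 ≤ τ * |u - v| := by positivity
  have n2 : 0 ≤ τ * |u + v| := by positivity
  rcases le_total B⁻¹ (τ * |u + v|) with h1 | h1
  · left
    have : (τ * |u - v|) * B⁻¹ ≤ B ^ 4 * σ := le_trans (by gcongr) e1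
    rw [← div_eq_mul_inv, div_le_iff₀ hB] at this
    linarith [this, show B ^ 4 * σ * B = B ^ 5 * σ by ring]
  · right
    have h2 : B⁻¹ ≤ τ * |u - v| := by linarith
    have : B⁻¹ * (τ * |u + v|) ≤ B ^ 4 * σ := le_trans (by gcongr) e1
    rw [inv_mul_le_iff₀ hB] at this
    linarith [this, show B * (B ^ 4 * σ) = B ^ 5 * σ by ring]

/-- far poles force the slope to be large -/
lemma real_slope (cg ch pg ph x τ s A M K ε : ℝ) (hτ : 0 < τ) (hA : 0 < A)
    (hg : A⁻¹ ≤ τ * |cg|) (hx : |x - ph| ≤ 2 * K)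
    (h : τ * |cg * (x - pg) - ε * (ch * (x - ph))| ≤ M * s)
    (hp : A * (M + 2 * K) * s < |pg - ph|) : s ≤ τ * |cg - ε * ch| := by
  by_contra hcon
  push Not at hcon
  have e1 : cg * (pg - ph) =
      -(cg * (x - pg) - ε * (ch * (x - ph))) + (cg - ε * ch) * (x - ph) := by ring
  have e2 : |cg| * |pg - ph| ≤
      |cg * (x - pg) - ε * (ch * (x - ph))| + |cg - ε * ch| * |x - ph| := by
    rw [← abs_mul, e1, ← abs_mul, ← abs_neg (cg * (x - pg) - ε * (ch * (x - ph)))]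
    exact abs_add_le _ _
  have e3 : A⁻¹ * |pg - ph| ≤ M * s + s * (2 * K) := by
    calc A⁻¹ * |pg - ph| ≤ τ * |cg| * |pg - ph| := by gcongr
      _ = τ * (|cg| * |pg - ph|) := by ring
      _ ≤ τ * (|cg * (x - pg) - ε * (ch * (x - ph))| + |cg - ε * ch| * |x - ph|) := by gcongr
      _ = τ * |cg * (x - pg) - ε * (ch * (x - ph))| + (τ * |cg - ε * ch|) * |x - ph| := by ring
      _ ≤ M * s + s * (2 * K) := by
        have : 0 ≤ s := le_trans (by positivity) hcon.le
        gcongr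
  rw [inv_mul_le_iff₀ hA] at e3
  linarith [show A * (M * s + s * (2 * K)) = A * (M + 2 * K) * s by ring]

lemma real_close (cg ch pg ph x y τ s M ε : ℝ) (hτ : 0 < τ) (hs : 0 < s)
    (hslope : s ≤ τ * |cg - ε * ch|)
    (h1 : τ * |cg * (x - pg) - ε * (ch * (x - ph))| ≤ M * s ^ 2)
    (h2 : τ * |cg * (y - pg) - ε * (ch * (y - ph))| ≤ M * s ^ 2) : |x - y| ≤ 2 * M * s := by
  have e1 : (cg - ε * ch) * (x - y) = (cg * (x - pg) - ε * (ch * (x - ph)))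
      - (cg * (y - pg) - ε * (ch * (y - ph))) := by ring
  have e2 : |cg - ε * ch| * |x - y| ≤ |cg * (x - pg) - ε * (ch * (x - ph))|
      + |cg * (y - pg) - ε * (ch * (y - ph))| := by
    rw [← abs_mul, e1]; exact abs_sub _ _
  have e3 : s * |x - y| ≤ s * (2 * M * s) := by
    calc s * |x - y| ≤ (τ * |cg - ε * ch|) * |x - y| := by gcongr
      _ = τ * (|cg - ε * ch| * |x - y|) := by ring
      _ ≤ τ * (|cg * (x - pg) - ε * (ch * (x - ph))|
          + |cg * (y - pg) - ε * (ch * (y - ph))|) := by gcongr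
      _ ≤ s * (2 * M * s) := by
        rw [mul_add]
        linarith [show s * (2 * M * s) = M * s ^ 2 + M * s ^ 2 by ring]
  exact le_of_mul_le_mul_left e3 hs

lemma fiber_count {X Y W : Type*} [DecidableEq Y] [DecidableEq W] (T : Finset X) (f : X → Y)
    (g : X → W) (Z : Finset Y) (M : ℝ) (hf : ∀ t ∈ T, f t ∈ Z)
    (hinj : ∀ t ∈ T, ∀ t' ∈ T, f t = f t' → g t = g t' → t = t')
    (hM : ∀ y ∈ Z, ∀ G : Finset W, (∀ w ∈ G, ∃ t ∈ T, f t = y ∧ g t = w) → (G.card : ℝ) ≤ M) :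
    (T.card : ℝ) ≤ Z.card * M := by
  rw [Finset.card_eq_sum_card_fiberwise (f := f) (t := Z) (fun t ht => hf t ht)]
  push_cast
  calc _ ≤ ∑ y ∈ Z, M := by
        apply Finset.sum_le_sum
        intro y hy
        rw [← Finset.card_image_of_injOn (f := g)]
        · apply hM y hy
          intro w hw
          obtain ⟨t, ht, rfl⟩ := Finset.mem_image.1 hw
          rw [Finset.mem_filter] at ht
          exact ⟨t, ht.1, ht.2, rfl⟩
        · intro t ht t' ht' h
          simp only [Finset.coe_filter, mem_setOf_eq] at ht ht'
          exact hinj t ht.1 t' ht'.1 (ht.2.trans ht'.2.symm) h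
    _ = _ := by simp

/-- The set of triples. -/
def trip (S : SchottkyData r) (τ σ : ℝ) (a : List (Fin (2 * r))) :
    Set (List (Fin (2 * r)) × List (Fin (2 * r)) × List (Fin (2 * r))) :=
  {t | t.1 ∈ S.Zpart τ ∧ t.2.1 ∈ S.Zpart τ ∧ t.2.2 ∈ S.Zpart τ ∧
          chn a t.1 ∧ chn t.1 t.2.2 ∧ chn a t.2.1 ∧ chn t.2.1 t.2.2 ∧
          |mobiusDeriv (S.wordγ (a.dropLast ++ t.1.dropLast)) (ctr (S.wordI t.2.2)) -
            mobiusDeriv (S.wordγ (a.dropLast ++ t.2.1.dropLast)) (ctr (S.wordI t.2.2))| ≤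
            τ ^ 2 * σ}

lemma Z_card (hδ0 : 0 < δ) (hμ : S.IsPS δ μ) : ∃ C > 0, ∀ τ : ℝ, 0 < τ → τ ≤ 1 →
    ∀ F : Finset (List (Fin (2 * r))), (∀ w ∈ F, w ∈ S.Zpart τ) →
    (F.card : ℝ) ≤ C * τ ^ (-δ) := by
  obtain ⟨K, hK⟩ := exists_good S
  have hK1 := hK.one_le
  have hK0 := hK.pos
  have h1 : 1 ≤ 128 * K ^ 18 := by
    have := one_le_pow₀ hK1 (n := 18)
    linarith
  obtain ⟨C, hC, h⟩ := count_ball hδ0 hμ (128 * K ^ 18) h1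
  refine ⟨C * K ^ δ, by positivity, ?_⟩
  intro τ hτ hτ1 F hF
  refine (h τ 0 K hτ (hτ1.trans hK1) F ?_).trans (le_of_eq (by ring))
  intro w hw
  obtain ⟨a1, a2, a3, _⟩ := mem_Z.1 (hF w hw)
  refine ⟨a1, a2, Z_lower hK τ hτ1 w (hF w hw), ?_, ctr (S.wordI w), ctr_mem S w a2 a1, ?_⟩
  · refine a3.trans ?_
    nlinarith
  · rw [sub_zero]
    exact wordI_bd hK w a2 a1 _ (ctr_mem S w a2 a1)

end TC

end

noncomputable section
open MeasureTheory Set Real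
namespace TC
variable {r : ℕ} {S : SchottkyData r} {K δ : ℝ} {μ : Measure ℝ}

/-- triples with close poles -/
lemma count_T1 (hK : Good S K) (hδ0 : 0 < δ) (hμ : S.IsPS δ μ) (R : ℝ) (hR : 1 ≤ R) :
    ∃ C > 0, ∀ τ s q : ℝ, 0 < τ → τ < K⁻¹ → τ ≤ s →
    ∀ a ∈ S.Zpart τ, ∀ d ∈ S.Zpart τ, ∀ G : Finset (List (Fin (2 * r))),
    (∀ v ∈ G, ∃ b ∈ S.Zpart τ, chn a b ∧ chn b d ∧ wbar b.dropLast = v ∧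
      |pole S (a.dropLast ++ b.dropLast) - q| ≤ R * s) → (G.card : ℝ) ≤ C * τ ^ (-δ) * s ^ δ := by
  have hK1 := hK.one_le
  have hK0 := hK.pos
  have h1 : 1 ≤ 4096 * K ^ 32 := by
    have := one_le_pow₀ hK1 (n := 32)
    linarith
  obtain ⟨C, hC, h⟩ := count_ball hδ0 hμ (4096 * K ^ 32) h1
  refine ⟨C * R ^ δ, by positivity, ?_⟩
  intro τ s q hτ hτK hτs a ha d hd G hG
  have hs : 0 < s := by linarith
  have h2 := h τ q (R * s) hτ (by nlinarith) G ?_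
  · refine h2.trans (le_of_eq ?_)
    rw [mul_rpow (by positivity) hs.le]; ring
  · intro v hv
    obtain ⟨b, hb, hab, hbd, rfl, hp⟩ := hG v hv
    obtain ⟨_, _, _, h4, h5, h6, h7, h8⟩ := pair_info hK hτ hτK ha hb hd hab hbd
    exact ⟨h4, h5, h6, h7, _, h8, hp⟩

lemma count_T2 (hK : Good S K) (hδ0 : 0 < δ) (hμ : S.IsPS δ μ) (R : ℝ) (hR : 1 ≤ R) :
    ∃ C > 0, ∀ τ s : ℝ, 0 < τ → τ ≤ 1 → τ ≤ s →
    ∀ G : Finset (List (Fin (2 * r))),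
    (∀ w ∈ G, w ∈ S.Zpart τ) →
    (∀ w ∈ G, ∀ w' ∈ G, |ctr (S.wordI w) - ctr (S.wordI w')| ≤ R * s) →
    (G.card : ℝ) ≤ C * τ ^ (-δ) * s ^ δ := by
  have hK1 := hK.one_le
  have hK0 := hK.pos
  have h1 : 1 ≤ 128 * K ^ 18 := by
    have := one_le_pow₀ hK1 (n := 18)
    linarith
  obtain ⟨C, hC, h⟩ := count_ball hδ0 hμ (128 * K ^ 18) h1
  refine ⟨C * R ^ δ, by positivity, ?_⟩
  intro τ s hτ hτ1 hτs G hG hGd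
  have hs : 0 < s := by linarith
  rcases G.eq_empty_or_nonempty with rfl | ⟨w0, hw0⟩
  · simp only [Finset.card_empty, Nat.cast_zero]; positivity
  have h2 := h τ (ctr (S.wordI w0)) (R * s) hτ (by nlinarith) G ?_
  · refine h2.trans (le_of_eq ?_)
    rw [mul_rpow (by positivity) hs.le]; ring
  · intro w hw
    obtain ⟨a1, a2, a3, _⟩ := mem_Z.1 (hG w hw)
    refine ⟨a1, a2, Z_lower hK τ hτ1 w (hG w hw), ?_, ctr (S.wordI w), ctr_mem S w a2 a1,
      hGd w hw w0 hw0⟩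
    refine a3.trans ?_
    nlinarith

lemma wbar_inj {u v : List (Fin (2 * r))} (h : wbar u = wbar v) : u = v := by
  have hb : Function.Injective (bar : Fin (2 * r) → Fin (2 * r)) :=
    Function.LeftInverse.injective bar_bar
  exact List.map_injective_iff.2 hb (List.reverse_injective h)

lemma trip_finite (S : SchottkyData r) (τ σ : ℝ) (hτ : 0 < τ) (a : List (Fin (2 * r))) :
    (trip S τ σ a).Finite := by
  have h := Z_finite S τ hτ
  apply (h.prod (h.prod h)).subset
  rintro ⟨b, c, d⟩ ht
  exact ⟨ht.1, ht.2.1, ht.2.2.1⟩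

set_option maxHeartbeats 2000000 in
theorem main (hδ0 : 0 < δ) (hμ : S.IsPS δ μ) :
    ∃ C > (0 : ℝ), ∀ τ σ : ℝ, 0 < τ → τ ≤ σ → σ ≤ 1 →
      ∀ a ∈ S.Zpart τ, (Set.ncard (trip S τ σ a) : ℝ) ≤ C * τ ^ (-(3 * δ)) * σ ^ (δ / 2) := by
  classical
  obtain ⟨K, hK⟩ := exists_good S
  have hK1 := hK.one_le
  have hK0 := hK.pos
  obtain ⟨A, hA⟩ : ∃ A, A = 512 * K ^ 26 := ⟨_, rfl⟩
  have hA1 : 1 ≤ A := by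
    have := one_le_pow₀ hK1 (n := 26)
    rw [hA]; linarith
  have hA0 : 0 < A := by linarith
  obtain ⟨B, hB⟩ : ∃ B, B = A * (2 * K) := ⟨_, rfl⟩
  have hB1 : 1 ≤ B := by rw [hB]; nlinarith
  have hB0 : 0 < B := by linarith
  obtain ⟨M, hM⟩ : ∃ M, M = B ^ 5 := ⟨_, rfl⟩
  have hM1 : 1 ≤ M := by rw [hM]; exact one_le_pow₀ hB1
  have hM0 : 0 < M := by linarith
  have hR1 : 1 ≤ A * (M + 2 * K) := by nlinarith
  obtain ⟨C0, hC0, hZ⟩ := Z_card hδ0 hμ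
  obtain ⟨C1, hC1, hT1⟩ := count_T1 hK hδ0 hμ (A * (M + 2 * K)) hR1
  obtain ⟨C2, hC2, hT2⟩ := count_T2 hK hδ0 hμ (2 * M) (by linarith)
  refine ⟨C0 ^ 3 * K ^ (δ / 2) + C0 ^ 2 * C1 + C0 ^ 2 * (2 * C2), by positivity, ?_⟩
  intro τ σ hτ hτσ hσ1 a ha
  have hσ : 0 < σ := by linarith
  have hτ1 : τ ≤ 1 := by linarith
  have hfin := trip_finite S τ σ hτ a
  rw [Set.ncard_eq_toFinset_card _ hfin]
  set T := hfin.toFinset with hT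
  have hTm : ∀ t ∈ T, t ∈ trip S τ σ a := fun t ht => by simpa [hT] using ht
  set Z := (Z_finite S τ hτ).toFinset with hZdef
  have hZm : ∀ w, w ∈ Z ↔ w ∈ S.Zpart τ := fun w => by simp [hZdef]
  have hZc : (Z.card : ℝ) ≤ C0 * τ ^ (-δ) := hZ τ hτ hτ1 Z fun w hw => (hZm w).1 hw
  have hZZ : ((Z ×ˢ Z).card : ℝ) ≤ C0 ^ 2 * (τ ^ (-δ)) ^ 2 := by
    rw [Finset.card_product]
    push_cast
    calc (Z.card : ℝ) * Z.card ≤ (C0 * τ ^ (-δ)) * (C0 * τ ^ (-δ)) := by gcongr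
      _ = _ := by ring
  have hτ3 : τ ^ (-(3 * δ)) = (τ ^ (-δ)) ^ 3 := by
    rw [← rpow_natCast, ← rpow_mul hτ.le]
    congr 1
    push_cast; ring
  rw [hτ3]
  have hP : 0 < τ ^ (-δ) := by positivity
  have hQ : 0 < σ ^ (δ / 2) := by positivity
  generalize hPe : τ ^ (-δ) = P at *
  rcases le_or_gt K⁻¹ τ with hcase | hcase
  · have h1 : (T.card : ℝ) ≤ C0 ^ 3 * P ^ 3 := by
      have h2 : T ⊆ Z ×ˢ (Z ×ˢ Z) := by
        intro t ht
        have := hTm t ht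
        simp only [Finset.mem_product, hZm]
        exact ⟨this.1, this.2.1, this.2.2.1⟩
      have h3 := Finset.card_le_card h2
      rw [Finset.card_product] at h3
      have h4 : (T.card : ℝ) ≤ Z.card * (Z ×ˢ Z).card := by exact_mod_cast h3
      calc _ ≤ _ := h4
        _ ≤ (C0 * P) * (C0 ^ 2 * P ^ 2) := by gcongr
        _ = _ := by ring
    have h2 : 1 ≤ K ^ (δ / 2) * σ ^ (δ / 2) := by
      rw [← mul_rpow hK0.le hσ.le]
      apply one_le_rpow _ (by positivity)
      rw [inv_le_iff_one_le_mul₀ hK0] at hcase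
      nlinarith
    calc (T.card : ℝ) ≤ C0 ^ 3 * P ^ 3 * 1 := by linarith
      _ ≤ C0 ^ 3 * P ^ 3 * (K ^ (δ / 2) * σ ^ (δ / 2)) := by gcongr
      _ = (C0 ^ 3 * K ^ (δ / 2)) * P ^ 3 * σ ^ (δ / 2) := by ring
      _ ≤ _ := by
        gcongr
        have : 0 < C0 ^ 2 * C1 := by positivity
        have : 0 < C0 ^ 2 * (2 * C2) := by positivity
        linarith
  -- main case
  obtain ⟨s, hs⟩ : ∃ s, s = √σ := ⟨_, rfl⟩
  have hs0 : 0 < s := by rw [hs]; exact sqrt_pos.2 hσ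
  have hs2 : s ^ 2 = σ := by rw [hs]; exact sq_sqrt hσ.le
  have hs1 : s ≤ 1 := by rw [hs]; exact sqrt_le_one.2 hσ1
  have hσs : σ ≤ s := by nlinarith
  have hτs : τ ≤ s := by linarith
  have hsδ : s ^ δ = σ ^ (δ / 2) := by
    rw [hs, sqrt_eq_rpow, ← rpow_mul hσ.le]
    congr 1; ring
  have hT1' := fun q => hT1 τ s q hτ hcase hτs a ha
  have hT2' := hT2 τ s hτ hτ1 hτs
  rw [hsδ] at hT2'
  simp only [hsδ] at hT1'
  rw [hPe] at hT2'
  simp only [hPe] at hT1'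
  generalize σ ^ (δ / 2) = Q at *
  set near : List (Fin (2 * r)) × List (Fin (2 * r)) × List (Fin (2 * r)) → Prop := fun t =>
    |pole S (a.dropLast ++ t.1.dropLast) - pole S (a.dropLast ++ t.2.1.dropLast)|
      ≤ A * (M + 2 * K) * s with hnear
  have hsplit : (T.card : ℝ) = (T.filter near).card + (T.filter (fun t => ¬ near t)).card := by
    exact_mod_cast (Finset.card_filter_add_card_filter_not (s := T) near).symm
  -- near part
  have hN : ((T.filter near).card : ℝ) ≤ (Z ×ˢ Z).card * (C1 * P * Q) := by
    refine fiber_count (T.filter near) (fun t => (t.2.1, t.2.2)) (fun t => wbar t.1.dropLast)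
      (Z ×ˢ Z) _ ?_ ?_ ?_
    · intro t ht
      have h := hTm t (Finset.mem_filter.1 ht).1
      simp only [Finset.mem_product, hZm]
      exact ⟨h.2.1, h.2.2.1⟩
    · rintro ⟨b, c, d⟩ ht ⟨b', c', d'⟩ ht' hf hg
      have h := hTm _ (Finset.mem_filter.1 ht).1
      have h' := hTm _ (Finset.mem_filter.1 ht').1
      simp only [Prod.mk.injEq] at hf
      obtain ⟨rfl, rfl⟩ := hf
      obtain ⟨-, -, -, -, ⟨h1, h2, h3⟩, -⟩ := h
      obtain ⟨-, -, -, -, ⟨h1', h2', h3'⟩, -⟩ := h'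
      have e := wbar_inj hg
      simp only at h1 h1' h3 h3' e
      have : b = b' := by
        rw [← List.dropLast_append_getLast h1, ← List.dropLast_append_getLast h1', e, h3, h3']
      rw [this]
    · rintro ⟨c, d⟩ hy G hG
      simp only [Finset.mem_product, hZm] at hy
      refine hT1' (pole S (a.dropLast ++ c.dropLast)) d hy.2 G ?_
      intro v hv
      obtain ⟨⟨b, c', d'⟩, ht, hf, hg⟩ := hG v hv
      simp only [Prod.mk.injEq] at hf
      obtain ⟨rfl, rfl⟩ := hf
      obtain ⟨ht1, ht2⟩ := Finset.mem_filter.1 ht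
      have h := hTm _ ht1
      exact ⟨b, h.1, h.2.2.2.1, h.2.2.2.2.1, hg, ht2⟩
  have hF : ((T.filter (fun t => ¬ near t)).card : ℝ) ≤ (Z ×ˢ Z).card * (2 * (C2 * P * Q)) := by
    refine fiber_count (T.filter (fun t => ¬ near t)) (fun t => (t.1, t.2.1)) (fun t => t.2.2)
      (Z ×ˢ Z) _ ?_ ?_ ?_
    · intro t ht
      have h := hTm t (Finset.mem_filter.1 ht).1
      simp only [Finset.mem_product, hZm]
      exact ⟨h.1, h.2.1⟩
    · rintro ⟨b, c, d⟩ ht ⟨b', c', d'⟩ ht' hf hg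
      simp only [Prod.mk.injEq] at hf hg ⊢
      exact ⟨hf.1, hf.2, hg⟩
    · rintro ⟨b, c⟩ hy G hG
      have hG' : ∀ d ∈ G, (b, c, d) ∈ trip S τ σ a ∧ ¬ near (b, c, d) := by
        intro d hd
        obtain ⟨⟨b', c', d'⟩, ht, hf, hg⟩ := hG d hd
        simp only [Prod.mk.injEq] at hf hg
        obtain ⟨rfl, rfl⟩ := hf
        obtain rfl := hg
        obtain ⟨ht1, ht2⟩ := Finset.mem_filter.1 ht
        exact ⟨hTm _ ht1, ht2⟩
      clear hG
      set cg := cc S (a.dropLast ++ b.dropLast) with hcg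
      set ch := cc S (a.dropLast ++ c.dropLast) with hch
      set pg := pole S (a.dropLast ++ b.dropLast) with hpg
      set ph := pole S (a.dropLast ++ c.dropLast) with hph
      have hfilt : ∀ ε : ℝ, ((G.filter (fun d => τ * |cg * (ctr (S.wordI d) - pg) -
          ε * (ch * (ctr (S.wordI d) - ph))| ≤ M * σ)).card : ℝ) ≤ C2 * P * Q := by
        intro ε
        refine hT2' _ (fun d hd => (hG' d (Finset.mem_filter.1 hd).1).1.2.2.1) ?_
        intro d hd d' hd'
        obtain ⟨hd1, hd2⟩ := Finset.mem_filter.1 hd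
        obtain ⟨hd1', hd2'⟩ := Finset.mem_filter.1 hd'
        obtain ⟨⟨q1, q2, q3, q4, q5, q6, q7, -⟩, hnr⟩ := hG' d hd1
        have hp : A * (M + 2 * K) * s < |pg - ph| := not_le.1 hnr
        obtain ⟨-, -, ⟨i1, -⟩, -⟩ := pair_info hK hτ hcase ha q1 q3 q4 q5
        obtain ⟨-, ⟨-, j1⟩, -⟩ := pair_info hK hτ hcase ha q2 q3 q6 q7
        rw [← hA] at i1
        have hsl := real_slope cg ch pg ph (ctr (S.wordI d)) τ s A M K ε hτ hA0 i1 j1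
          (hd2.trans (by gcongr)) hp
        rw [← hs2] at hd2 hd2'
        exact real_close cg ch pg ph _ _ τ s M ε hτ hs0 hsl hd2 hd2'
      have hcov : G ⊆ (G.filter (fun d => τ * |cg * (ctr (S.wordI d) - pg) -
          1 * (ch * (ctr (S.wordI d) - ph))| ≤ M * σ)) ∪
          (G.filter (fun d => τ * |cg * (ctr (S.wordI d) - pg) -
          (-1) * (ch * (ctr (S.wordI d) - ph))| ≤ M * σ)) := by
        intro d hd
        obtain ⟨⟨q1, q2, q3, q4, q5, q6, q7, q8⟩, hnr⟩ := hG' d hd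
        obtain ⟨i1, ⟨i2, i3⟩, ⟨i4, i5⟩, -⟩ := pair_info hK hτ hcase ha q1 q3 q4 q5
        obtain ⟨j1, ⟨j2, j3⟩, ⟨j4, j5⟩, -⟩ := pair_info hK hτ hcase ha q2 q3 q6 q7
        simp only at q1 q2 q3 q4 q5 q6 q7 q8 i1 i2 i3 i4 i5 j1 j2 j3 j4 j5
        rw [i1, j1] at q8
        rw [← hA] at i4 i5 j4 j5
        have hlow : ∀ u v : ℝ, A⁻¹ ≤ τ * |u| → K⁻¹ ≤ |v| → B⁻¹ ≤ τ * |u * v| := by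
          intro u v h1 h2
          rw [abs_mul, ← mul_assoc]
          calc B⁻¹ ≤ A⁻¹ * K⁻¹ := by
                rw [hB, ← mul_inv]
                apply inv_anti₀ (by positivity)
                nlinarith
            _ ≤ _ := by gcongr
        have hup : ∀ u v : ℝ, τ * |u| ≤ A → |v| ≤ 2 * K → τ * |u * v| ≤ B := by
          intro u v h1 h2
          rw [abs_mul, ← mul_assoc, hB]
          gcongr
        have := real_sign _ _ B τ σ hB0 hτ (hlow _ _ i4 i2) (hup _ _ i5 i3)
          (hlow _ _ j4 j2) (hup _ _ j5 j3) q8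
        rw [← hM] at this
        rw [Finset.mem_union, Finset.mem_filter, Finset.mem_filter]
        rcases this with h | h
        · exact Or.inl ⟨hd, h⟩
        · exact Or.inr ⟨hd, h⟩
      have h1 := (Finset.card_le_card hcov).trans (Finset.card_union_le _ _)
      have h2 : (G.card : ℝ) ≤ _ := Nat.cast_le.2 h1
      push_cast at h2
      have h3 := hfilt 1
      have h4 := hfilt (-1)
      linarith
  rw [hsplit]
  calc _ ≤ (Z ×ˢ Z).card * (C1 * P * Q) + (Z ×ˢ Z).card * (2 * (C2 * P * Q)) := add_le_add hN hF
    _ ≤ (C0 ^ 2 * P ^ 2) * (C1 * P * Q) + (C0 ^ 2 * P ^ 2) * (2 * (C2 * P * Q)) := by gcongr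
    _ = (C0 ^ 2 * C1 + C0 ^ 2 * (2 * C2)) * P ^ 3 * Q := by ring
    _ ≤ _ := by
      gcongr
      have : 0 < C0 ^ 3 * K ^ (δ / 2) := by positivity
      linarith

end TC

end

noncomputable section

open MeasureTheory Set Real

/-- **Triple counting (positive box dimension input):** there is `C_Γ > 0` depending only on
the Schottky data such that for all `0 < τ ≤ σ ≤ 1` and every `𝐚 ∈ Z(τ)`:
`#{(𝐛,𝐜,𝐝) ∈ Z(τ)³ : 𝐚 ⇝ 𝐛 ⇝ 𝐝, 𝐚 ⇝ 𝐜 ⇝ 𝐝,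
|γ'_{𝐚'𝐛'}(x_𝐝) − γ'_{𝐚'𝐜'}(x_𝐝)| ≤ τ²σ} ≤ C_Γ τ^{-3δ} σ^{δ/2}`,
where `x_𝐝` is the center of `I_𝐝`. -/
theorem triple_count (r : ℕ) (S : SchottkyData r) (δ : ℝ)
    (hδ0 : 0 < δ) (hδ1 : δ < 1) (μ : Measure ℝ) (hμ : S.IsPS δ μ) :
    ∃ C > (0 : ℝ), ∀ τ σ : ℝ, 0 < τ → τ ≤ σ → σ ≤ 1 →
      ∀ a ∈ S.Zpart τ,
      (Set.ncard {t : List (Fin (2 * r)) × List (Fin (2 * r)) × List (Fin (2 * r)) |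
          t.1 ∈ S.Zpart τ ∧ t.2.1 ∈ S.Zpart τ ∧ t.2.2 ∈ S.Zpart τ ∧
          chn a t.1 ∧ chn t.1 t.2.2 ∧ chn a t.2.1 ∧ chn t.2.1 t.2.2 ∧
          |mobiusDeriv (S.wordγ (a.dropLast ++ t.1.dropLast)) (ctr (S.wordI t.2.2)) -
            mobiusDeriv (S.wordγ (a.dropLast ++ t.2.1.dropLast)) (ctr (S.wordI t.2.2))| ≤
            τ ^ 2 * σ} : ℝ)
        ≤ C * τ ^ (-(3 * δ)) * σ ^ (δ / 2) := by
  exact TC.main hδ0 hμ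

end
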